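/- arXiv:1112.0600 — 4 statements merged into one kernel-verified Lean document; each statement's English description precedes it below -/
import Mathlib

section
/- Let R be an h-local Prüfer domain and let M be a module that is a countable direct sum of (nonzero) ideals of R. Then every pure submodule of M is isomorphic to a direct sum of ideals of R. -/
open DirectSum Cardinal

universe u v w

variable (R : Type u) [CommRing R] [IsDomain R]

/-- A submodule `N` of `M` is *pure* if every finite system of `R`-linear equations with
constants in `N` that is solvable in `M` is solvable in `N`. -/
def IsPureSub {M : Type v} [AddCommGroup M] [Module R M] (N : Submodule R M) : Prop :=
  ∀ (n m : ℕ) (r : Fin n → Fin m → R) (a : Fin n → M),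
    (∀ i, a i ∈ N) →
    (∃ x : Fin m → M, ∀ i, ∑ j, r i j • x j = a i) →
    (∃ y : Fin m → M, (∀ j, y j ∈ N) ∧ ∀ i, ∑ j, r i j • y j = a i)

/-- A submodule `A ≤ B` is *balanced* if `B/A` is torsion-free and every rank-1
torsion-free module has the projective property w.r.t. `0 → A → B → B/A → 0`. -/
def IsBalanced {B : Type v} [AddCommGroup B] [Module R B] (A : Submodule R B) : Prop :=
  NoZeroSMulDivisors R (B ⧸ A) ∧
  ∀ (J : Type w) [AddCommGroup J] [Module R J], NoZeroSMulDivisors R J →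
    Module.rank R J = 1 →
    ∀ φ : J →ₗ[R] B ⧸ A, ∃ ψ : J →ₗ[R] B, A.mkQ ∘ₗ ψ = φ

/-- `M` is isomorphic to a direct sum of ideals of `R`. -/
def IsDirectSumOfIdeals (M : Type v) [AddCommGroup M] [Module R M] : Prop :=
  ∃ (ι : Type w) (I : ι → Ideal R), Nonempty (M ≃ₗ[R] ⨁ i, ↥(I i))

/-- `R` is an h-local domain. -/
def IsHLocal : Prop :=
  (∀ P : Ideal R, P.IsPrime → P ≠ ⊥ → ∃! m : Ideal R, m.IsMaximal ∧ P ≤ m) ∧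
  (∀ r : R, r ≠ 0 → {m : Ideal R | m.IsMaximal ∧ r ∈ m}.Finite)

/-- `R` is a Prüfer domain: finitely generated ideals are projective. -/
def IsPruefer : Prop := ∀ I : Ideal R, I.FG → Module.Projective R ↥I

/-- A `G(ℵ₀)`-family of submodules of `M`. -/
def IsGAleph0Family {M : Type v} [AddCommGroup M] [Module R M]
    (𝓑 : Set (Submodule R M)) : Prop :=
  ⊥ ∈ 𝓑 ∧ ⊤ ∈ 𝓑 ∧
  (∀ c ⊆ 𝓑, c.Nonempty → IsChain (· ≤ ·) c → sSup c ∈ 𝓑) ∧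
  (∀ A₀ ∈ 𝓑, ∀ H : Set M, H.Countable →
    ∃ A ∈ 𝓑, A₀ ≤ A ∧ H ⊆ (A : Set M) ∧
      ∃ S : Set M, S.Countable ∧ S ⊆ (A : Set M) ∧ A ≤ A₀ ⊔ Submodule.span R S)

/-- Local comparability in a Prüfer domain. -/
theorem aux_val (hP : IsPruefer R) (m : Ideal R) [hm : m.IsMaximal] (a b : R) :
    ∃ t, t ∉ m ∧ ((∃ u, t * a = u * b) ∨ (∃ u, t * b = u * a)) := by
  have h1 : (1 : R) ∉ m := fun h => hm.ne_top ((Ideal.eq_top_iff_one m).2 h)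
  by_cases ha : a = 0
  · exact ⟨1, h1, Or.inl ⟨0, by simp [ha]⟩⟩
  have hfg : (Ideal.span {a, b} : Ideal R).FG := Submodule.fg_span (Set.toFinite _)
  have := hP _ hfg
  set P : Ideal R := Ideal.span {a, b} with hPdef
  have haP : a ∈ P := Ideal.subset_span (by simp)
  have hbP : b ∈ P := Ideal.subset_span (by simp)
  let g : (R × R) →ₗ[R] P :=
    (LinearMap.toSpanSingleton R P ⟨a, haP⟩).coprod (LinearMap.toSpanSingleton R P ⟨b, hbP⟩)
  have hg : Function.Surjective g := by
    rintro ⟨y, hy⟩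
    obtain ⟨p, q, hpq⟩ := Ideal.mem_span_pair.1 hy
    exact ⟨(p, q), by ext; simpa [g] using hpq⟩
  obtain ⟨s, hs⟩ := Module.projective_lifting_property g LinearMap.id hg
  have key : ∀ y : P, (s y).1 * a + (s y).2 * b = y := by
    intro y
    have := congrArg Subtype.val (LinearMap.congr_fun hs y)
    simpa [g] using this
  have comm : a • s ⟨b, hbP⟩ = b • s ⟨a, haP⟩ := by
    rw [← map_smul, ← map_smul]; congr 1; ext; simp [mul_comm]
  have c1 : a * (s ⟨b, hbP⟩).1 = b * (s ⟨a, haP⟩).1 := congrArg Prod.fst comm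
  have c2 : a * (s ⟨b, hbP⟩).2 = b * (s ⟨a, haP⟩).2 := congrArg Prod.snd comm
  have ka := key ⟨a, haP⟩
  simp only at ka
  have hsum : (s ⟨a, haP⟩).1 + (s ⟨b, hbP⟩).2 = 1 := by
    apply mul_left_cancel₀ ha
    linear_combination ka + c2
  by_cases hu : (s ⟨a, haP⟩).1 ∈ m
  · refine ⟨(s ⟨b, hbP⟩).2, fun hv => h1 (hsum ▸ m.add_mem hu hv), Or.inl ⟨(s ⟨a, haP⟩).2, ?_⟩⟩
    linear_combination c2
  · exact ⟨_, hu, Or.inr ⟨(s ⟨b, hbP⟩).1, by linear_combination -c1⟩⟩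

/-- Separation of two maximal ideals in an h-local domain. -/
theorem aux_sep (hH : IsHLocal R) (m m' : Ideal R) (hm : m.IsMaximal) (hm' : m'.IsMaximal)
    (hne : m ≠ m') (r : R) (hr : r ≠ 0) :
    ∃ s t, s ∉ m ∧ t ∉ m' ∧ ∃ u, s * t = u * r := by
  by_contra hcon
  push Not at hcon
  have := hm.isPrime
  have := hm'.isPrime
  have hd : Disjoint ((Ideal.span {r} : Ideal R) : Set R)
      ((m.primeCompl ⊔ m'.primeCompl : Submonoid R) : Set R) := by
    rw [Set.disjoint_left]
    intro z hz hz'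
    obtain ⟨s, hs, t, ht, rfl⟩ := Submonoid.mem_sup.1 hz'
    obtain ⟨u, hu⟩ := Ideal.mem_span_singleton'.1 hz
    exact hcon s t hs ht u hu.symm
  obtain ⟨P, hPp, hle, hdis⟩ := Ideal.exists_le_prime_disjoint _ _ hd
  have hrP : r ∈ P := hle (Ideal.mem_span_singleton_self r)
  have hP0 : P ≠ ⊥ := fun h => hr (by simpa [h] using hrP)
  have hPm : P ≤ m := by
    intro z hz
    by_contra hzm
    exact Set.disjoint_left.1 hdis hz
      ((le_sup_left : m.primeCompl ≤ m.primeCompl ⊔ m'.primeCompl) hzm)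
  have hPm' : P ≤ m' := by
    intro z hz
    by_contra hzm
    exact Set.disjoint_left.1 hdis hz
      ((le_sup_right : m'.primeCompl ≤ m.primeCompl ⊔ m'.primeCompl) hzm)
  exact hne ((hH.1 P hPp hP0).unique ⟨hm, hPm⟩ ⟨hm', hPm'⟩)

/-- Localization of the conductor `(X : Y)` in an h-local domain. -/
theorem aux_loc (hH : IsHLocal R) (m : Ideal R) (hm : m.IsMaximal) (X Y : Ideal R)
    (r : R) (hr : r ≠ 0) (hrY : ∀ c ∈ Y, r * c ∈ X)
    (hloc : ∀ c ∈ Y, ∃ t, t ∉ m ∧ t * c ∈ X) :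
    ∃ s, s ∉ m ∧ ∀ c ∈ Y, s * c ∈ X := by
  classical
  have := hm.isPrime
  have hfin := hH.2 r hr
  have hsep : ∀ m' : Ideal R, ∃ s, s ∉ m ∧
      (m'.IsMaximal → m ≠ m' → ∃ t, t ∉ m' ∧ ∃ u, s * t = u * r) := by
    intro m'
    by_cases h : m'.IsMaximal ∧ m ≠ m'
    · obtain ⟨s, t, hs, ht, hu⟩ := aux_sep R hH m m' hm h.1 h.2 r hr
      exact ⟨s, hs, fun _ _ => ⟨t, ht, hu⟩⟩
    · exact ⟨1, fun h => hm.ne_top ((Ideal.eq_top_iff_one m).2 h),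
        fun h1 h2 => absurd ⟨h1, h2⟩ h⟩
  choose s hs hs' using hsep
  refine ⟨∏ i ∈ hfin.toFinset, s i, ?_, ?_⟩
  · intro h
    obtain ⟨i, _, hi⟩ := (Ideal.IsPrime.prod_mem_iff (p := m)).1 h
    exact hs i hi
  · intro c hc
    set σ := ∏ i ∈ hfin.toFinset, s i with hσ
    let K : Ideal R := Submodule.comap (LinearMap.toSpanSingleton R R (σ * c)) X
    have hK : ∀ z, z ∈ K ↔ z * (σ * c) ∈ X := fun z => by simp [K]
    have htop : K = ⊤ := by
      by_contra hne
      obtain ⟨m', hm', hle⟩ := Ideal.exists_le_maximal K hne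
      by_cases hmm : m = m'
      · subst hmm
        obtain ⟨t, ht, htc⟩ := hloc c hc
        refine ht (hle ((hK t).2 ?_))
        have : t * (σ * c) = σ * (t * c) := by ring
        rw [this]; exact X.mul_mem_left _ htc
      · have hrm : r ∈ m' := by
          refine hle ((hK r).2 ?_)
          have : r * (σ * c) = σ * (r * c) := by ring
          rw [this]; exact X.mul_mem_left _ (hrY c hc)
        obtain ⟨t, ht, u, hu⟩ := hs' m' hm' hmm
        refine ht (hle ((hK t).2 ?_))
        obtain ⟨v, hv⟩ : s m' ∣ σ :=
          Finset.dvd_prod_of_mem s (hfin.mem_toFinset.2 ⟨hm', hrm⟩)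
        have : t * (σ * c) = (v * u) * (r * c) := by
          rw [hv]; linear_combination v * c * hu
        rw [this]; exact X.mul_mem_left _ (hrY c hc)
    have : (1 : R) ∈ K := htop ▸ Submodule.mem_top
    simpa using (hK 1).1 this

theorem aux_min {ι : Type*} (r : ι → ι → Prop) (htr : ∀ a b c, r a b → r b c → r a c)
    (s : Finset ι) (htot : ∀ a ∈ s, ∀ b ∈ s, r a b ∨ r b a) (hs : s.Nonempty) :
    ∃ k ∈ s, ∀ i ∈ s, r k i := by
  classical
  induction hs using Finset.Nonempty.cons_induction with
  | singleton a =>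
    exact ⟨a, by simp, fun i hi => by
      rw [Finset.mem_singleton] at hi; subst hi
      simpa using htot i (by simp) i (by simp)⟩
  | cons a s ha hs ih =>
    obtain ⟨k, hk, hki⟩ := ih fun x hx y hy =>
      htot x (Finset.mem_cons_of_mem hx) y (Finset.mem_cons_of_mem hy)
    have haa : r a a := by
      simpa using htot a (Finset.mem_cons_self a s) a (Finset.mem_cons_self a s)
    rcases htot a (Finset.mem_cons_self a s) k (Finset.mem_cons_of_mem hk) with h | h
    · refine ⟨a, Finset.mem_cons_self a s, fun i hi => ?_⟩
      rcases Finset.mem_cons.1 hi with rfl | hi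
      · exact haa
      · exact htr _ _ _ h (hki i hi)
    · refine ⟨k, Finset.mem_cons_of_mem hk, fun i hi => ?_⟩
      rcases Finset.mem_cons.1 hi with rfl | hi
      · exact h
      · exact hki i hi

/-- coordinate map -/
noncomputable def cmap (I : ℕ → Ideal R) (k : ℕ) : (⨁ n, ↥(I n)) →ₗ[R] R :=
  (I k).subtype ∘ₗ DirectSum.component R ℕ (fun n => ↥(I n)) k

theorem cmap_mem (I : ℕ → Ideal R) (k : ℕ) (z) : cmap R I k z ∈ I k := by
  simp [cmap]

theorem cmap_ext (I : ℕ → Ideal R) (z w : ⨁ n, ↥(I n))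
    (h : ∀ k, cmap R I k z = cmap R I k w) : z = w := by
  refine DFinsupp.ext fun k => Subtype.ext (h k)

theorem cmap_fin (I : ℕ → Ideal R) (z : ⨁ n, ↥(I n)) :
    ∃ s : Finset ℕ, ∀ i, i ∈ s ↔ cmap R I i z ≠ 0 := by
  classical
  refine ⟨DFinsupp.support z, fun i => ?_⟩
  rw [DFinsupp.mem_support_iff, ne_eq, ne_eq, not_iff_not]
  exact Subtype.ext_iff

theorem cmap_mk (I : ℕ → Ideal R) (s : Finset ℕ) (d : ℕ → R) (hd : ∀ i, d i ∈ I i)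
    (h0 : ∀ i, i ∉ s → d i = 0) : ∃ z : ⨁ n, ↥(I n), ∀ i, cmap R I i z = d i := by
  classical
  refine ⟨DFinsupp.mk s fun i => ⟨d i, hd i⟩, fun i => ?_⟩
  change (((DFinsupp.mk s fun i => ⟨d i, hd i⟩ : Π₀ n, ↥(I n)) i : ↥(I i)) : R) = d i
  rw [DFinsupp.mk_apply]
  split_ifs with h
  · rfl
  · simp [h0 i h]

/-- A relatively divisible rank one submodule is a retract. -/
theorem aux_rank1 (hH : IsHLocal R) (hP : IsPruefer R) (I : ℕ → Ideal R)
    (B : Submodule R (⨁ n, ↥(I n)))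
    (hB : ∀ (r : R) z, r ≠ 0 → r • z ∈ B → z ∈ B)
    (x : ⨁ n, ↥(I n)) (hx : x ∈ B) (hx0 : x ≠ 0)
    (hr : ∀ y ∈ B, ∀ i j, cmap R I i y * cmap R I j x = cmap R I j y * cmap R I i x) :
    ∃ f : (⨁ n, ↥(I n)) →ₗ[R] (⨁ n, ↥(I n)), (∀ z, f z ∈ B) ∧ ∀ z ∈ B, f z = z := by
  classical
  obtain ⟨S, hS⟩ := cmap_fin R I x
  have hSne : S.Nonempty := by
    by_contra h
    rw [Finset.not_nonempty_iff_eq_empty] at h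
    apply hx0
    apply cmap_ext R I
    intro k
    have := hS k
    simp only [h, Finset.notMem_empty, false_iff, not_not] at this
    simpa using this
  let J : ℕ → Ideal R := fun k => B.map (cmap R I k)
  let a : ℕ → Ideal R := fun k => (J k).colon (I k : Set R)
  have ha : ∀ k s, s ∈ a k ↔ ∀ c ∈ I k, s * c ∈ J k := by
    intro k s
    simp [a, Submodule.mem_colon]
  have hinj : ∀ k ∈ S, ∀ y ∈ B, ∀ z ∈ B, cmap R I k y = cmap R I k z → y = z := by
    intro k hk y hy z hz h
    apply cmap_ext
    intro i
    apply mul_right_cancel₀ ((hS k).1 hk)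
    rw [hr y hy i k, hr z hz i k, h]
  have hsup : ⨆ k ∈ S, a k = ⊤ := by
    by_contra hne
    obtain ⟨m, hm, hle⟩ := Ideal.exists_le_maximal _ hne
    have := hm.isPrime
    -- local minimal index
    obtain ⟨k, hk, hki⟩ := aux_min (ι := S) (fun k i => ∀ c ∈ I k, ∃ t, t ∉ m ∧ ∃ d ∈ I i,
        t * c * cmap R I i x = d * cmap R I k x) (by
          rintro ⟨k, hk⟩ ⟨i, hi⟩ ⟨j, hj⟩ h1 h2 c hc
          obtain ⟨t, ht, d, hd, e⟩ := h1 c hc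
          obtain ⟨t', ht', d', hd', e'⟩ := h2 d hd
          refine ⟨t * t', fun h => (hm.isPrime.mem_or_mem h).elim ht ht', d', hd', ?_⟩
          apply mul_left_cancel₀ ((hS i).1 hi)
          simp only at e e' ⊢
          linear_combination t' * cmap R I j x * e + cmap R I k x * e')
        S.attach (by
          rintro ⟨k, hk⟩ - ⟨i, hi⟩ -
          rw [or_iff_not_imp_left]
          intro hcon d hd
          push Not at hcon
          obtain ⟨c, hc, hcon⟩ := hcon
          obtain ⟨t, ht, ⟨u, hu⟩ | ⟨u, hu⟩⟩ :=
            aux_val R hP m (c * cmap R I i x) (d * cmap R I k x)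
          · exact absurd (by simp only; linear_combination hu)
              (hcon t ht (u * d) ((I i).mul_mem_left _ hd))
          · exact ⟨t, ht, u * c, (I k).mul_mem_left _ hc,
              by simp only; linear_combination hu⟩)
        (by simpa using hSne)
    obtain ⟨k, hkS⟩ := k
    have hxk := (hS k).1 hkS
    have hk1 : ∀ i ∈ S, ∀ c ∈ I k, ∃ t, t ∉ m ∧ ∃ d ∈ I i,
        t * c * cmap R I i x = d * cmap R I k x := fun i hi => hki ⟨i, hi⟩ (by simp)
    obtain ⟨s, hs, hs'⟩ := aux_loc R hH m hm (J k) (I k) (cmap R I k x) hxk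
      (by
        intro c hc
        exact ⟨c • x, B.smul_mem c hx, by simp [mul_comm]⟩)
      (by
        intro c hc
        choose! t ht d hd e using fun i hi => hk1 i hi c hc
        have hd' : ∀ i, ∃ d' ∈ I i, i ∈ S → d' = (∏ l ∈ S.erase i, t l) * d i := by
          intro i
          by_cases hi : i ∈ S
          · exact ⟨_, (I i).mul_mem_left _ (hd i hi), fun _ => rfl⟩
          · exact ⟨0, (I i).zero_mem, fun h => absurd h hi⟩
        obtain ⟨y, hy⟩ := cmap_mk R I S
          (fun i => if i ∈ S then (∏ l ∈ S.erase i, t l) * d i else 0)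
          (by
            intro i
            by_cases hi : i ∈ S
            · simp only [hi, if_true]; exact (I i).mul_mem_left _ (hd i hi)
            · simp only [hi, if_false]; exact (I i).zero_mem)
          (by intro i hi; simp [hi])
        have hyk : ∀ i, cmap R I k x * cmap R I i y = (∏ l ∈ S, t l) * c * cmap R I i x := by
          intro i
          rw [hy i]
          by_cases hi : i ∈ S
          · simp only [hi, if_true]
            rw [← Finset.mul_prod_erase S t hi]
            linear_combination -(∏ l ∈ S.erase i, t l) * e i hi
          · have : cmap R I i x = 0 := by
              by_contra h; exact hi ((hS i).2 h)
            simp [hi, this]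
        have hyB : y ∈ B := by
          apply hB _ _ hxk
          have : cmap R I k x • y = ((∏ l ∈ S, t l) * c) • x := by
            apply cmap_ext; intro i
            simpa using hyk i
          rw [this]; exact B.smul_mem _ hx
        refine ⟨∏ l ∈ S, t l, ?_, y, hyB, ?_⟩
        · intro h
          obtain ⟨i, hi, h⟩ := (Ideal.IsPrime.prod_mem_iff (p := m)).1 h
          exact ht i hi h
        · apply mul_left_cancel₀ hxk
          rw [hyk k]; ring)
    exact hs (hle ((le_iSup₂ (f := fun k (_ : k ∈ S) => a k) k hkS) ((ha k s).2 hs')))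
  have h1 : (1 : R) ∈ ⨆ k ∈ S, a k := hsup ▸ Submodule.mem_top
  obtain ⟨μ, hμ⟩ := (Submodule.mem_iSup_finset_iff_exists_sum (s := S) a 1).1 h1
  -- the maps
  have hmap : ∀ k, ∃ g : (⨁ n, ↥(I n)) →ₗ[R] (⨁ n, ↥(I n)), k ∈ S →
      (∀ z, g z ∈ B) ∧ ∀ z ∈ B, g z = (μ k : R) • z := by
    intro k
    by_cases hk : k ∈ S
    swap
    · exact ⟨0, fun h => absurd h hk⟩
    have hex : ∀ z, ∃ y ∈ B, cmap R I k y = (μ k : R) * cmap R I k z := fun z =>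
      (ha k _).1 (μ k).2 _ (cmap_mem R I k z)
    choose g hgB hg using hex
    refine ⟨⟨⟨g, ?_⟩, ?_⟩, fun _ => ⟨hgB, ?_⟩⟩
    · intro z w
      apply hinj k hk _ (hgB _) _ (B.add_mem (hgB _) (hgB _))
      simp [hg, mul_add]
    · intro r z
      apply hinj k hk _ (hgB _) _ (B.smul_mem _ (hgB _))
      simp [hg]; ring
    · intro z hz
      apply hinj k hk _ (hgB _) _ (B.smul_mem _ hz)
      change cmap R I k (g z) = _
      simp [hg]
  choose g hg using hmap
  refine ⟨∑ k ∈ S, g k, fun z => ?_, fun z hz => ?_⟩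
  · rw [LinearMap.sum_apply]
    exact B.sum_mem fun k hk => (hg k hk).1 z
  · rw [LinearMap.sum_apply, Finset.sum_congr rfl fun k hk => (hg k hk).2 z hz,
      ← Finset.sum_smul, hμ, one_smul]

/-- truncation of `A` to the first `n` coordinates -/
noncomputable def trunc (I : ℕ → Ideal R) (A : Submodule R (⨁ n, ↥(I n))) (n : ℕ) :
    Submodule R (⨁ n, ↥(I n)) :=
  A ⊓ ⨅ i ≥ n, LinearMap.ker (cmap R I i)

theorem mem_trunc (I : ℕ → Ideal R) (A : Submodule R (⨁ n, ↥(I n))) (n : ℕ) (z) :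
    z ∈ trunc R I A n ↔ z ∈ A ∧ ∀ i, n ≤ i → cmap R I i z = 0 := by
  simp [trunc, Submodule.mem_iInf]

theorem aux_inj (I : ℕ → Ideal R) (A : Submodule R (⨁ n, ↥(I n))) (n : ℕ)
    (e : (⨁ n, ↥(I n)) →ₗ[R] (⨁ n, ↥(I n)))
    (he : ∀ z ∈ trunc R I A n, e z = z)
    (z) (hz : z ∈ trunc R I A (n + 1)) (hez : e z = 0) (h0 : cmap R I n z = 0) : z = 0 := by
  rw [← he z, hez]
  rw [mem_trunc] at hz ⊢
  refine ⟨hz.1, fun i hi => ?_⟩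
  rcases hi.eq_or_lt with rfl | h
  · exact h0
  · exact hz.2 i h

theorem aux_retract (hH : IsHLocal R) (hP : IsPruefer R) (I : ℕ → Ideal R)
    (A : Submodule R (⨁ n, ↥(I n)))
    (hA : ∀ (r : R) z, r ≠ 0 → r • z ∈ A → z ∈ A) (n : ℕ) :
    ∃ e : (⨁ n, ↥(I n)) →ₗ[R] (⨁ n, ↥(I n)),
      (∀ z, e z ∈ trunc R I A n) ∧ ∀ z ∈ trunc R I A n, e z = z := by
  induction n with
  | zero =>
    refine ⟨0, fun z => by simp, fun z hz => ?_⟩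
    symm
    apply cmap_ext
    intro k
    simpa using ((mem_trunc R I A 0 z).1 hz).2 k (Nat.zero_le k)
  | succ n ih =>
    obtain ⟨e, he1, he2⟩ := ih
    have hle : trunc R I A n ≤ trunc R I A (n + 1) := by
      intro z hz
      rw [mem_trunc] at hz ⊢
      exact ⟨hz.1, fun i hi => hz.2 i (by omega)⟩
    let B := trunc R I A (n + 1) ⊓ LinearMap.ker e
    have hf : ∃ f : (⨁ n, ↥(I n)) →ₗ[R] (⨁ n, ↥(I n)), (∀ z, f z ∈ B) ∧ ∀ z ∈ B, f z = z := by
      by_cases hB : B = ⊥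
      · exact ⟨0, fun z => by simp, fun z hz => by
          rw [hB, Submodule.mem_bot] at hz; simp [hz]⟩
      obtain ⟨x, hx, hx0⟩ := Submodule.exists_mem_ne_zero_of_ne_bot hB
      have hxn : cmap R I n x ≠ 0 := fun h => hx0 (aux_inj R I A n e he2 x hx.1 hx.2 h)
      refine aux_rank1 R hH hP I B ?_ x hx hx0 ?_
      · intro r z hr hz
        have h1 := (mem_trunc R I A _ _).1 hz.1
        have h2 : e (r • z) = 0 := hz.2
        refine ⟨(mem_trunc R I A _ _).2 ⟨hA r z hr h1.1, fun i hi => ?_⟩, ?_⟩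
        · have := h1.2 i hi
          simpa [hr] using this
        · change e z = 0
          apply cmap_ext
          intro i
          have := congrArg (cmap R I i) h2
          simpa [hr] using this
      · intro y hy i j
        have h0 : cmap R I n x • y - cmap R I n y • x = 0 := by
          have hmem := B.sub_mem (B.smul_mem (cmap R I n x) hy) (B.smul_mem (cmap R I n y) hx)
          refine aux_inj R I A n e he2 _ hmem.1 hmem.2 ?_
          simp [mul_comm]
        have hi := congrArg (cmap R I i) h0
        have hj := congrArg (cmap R I j) h0
        simp only [map_sub, map_smul, smul_eq_mul, map_zero] at hi hj
        apply mul_left_cancel₀ hxn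
        linear_combination cmap R I j x * hi - cmap R I i x * hj
    obtain ⟨f, hf1, hf2⟩ := hf
    refine ⟨e + f ∘ₗ (LinearMap.id - e), fun z => ?_, fun z hz => ?_⟩
    · exact Submodule.add_mem _ (hle (he1 z)) (hf1 _).1
    · have : z - e z ∈ B := by
        refine ⟨Submodule.sub_mem _ hz (hle (he1 z)), ?_⟩
        change e (z - e z) = 0
        rw [map_sub, he2 _ (he1 z), sub_self]
      change e z + f (z - e z) = z
      rw [hf2 _ this]; abel

/-- (universe-explicit version) over an h-local Prüfer domain, every pure submodule of a countable
direct sum of nonzero ideals is isomorphic to a direct sum of ideals. -/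
theorem aux_main (hH : IsHLocal R) (hP : IsPruefer R)
    (I : ℕ → Ideal R) 
    (A : Submodule R (⨁ n, ↥(I n))) (hA : IsPureSub R A) :
    IsDirectSumOfIdeals.{u, u, w} R ↥A := by
  classical
  have hA' : ∀ (r : R) z, r ≠ 0 → r • z ∈ A → z ∈ A := by
    intro r z hr hz
    obtain ⟨y, hy, hy'⟩ := hA 1 1 (fun _ _ => r) (fun _ => r • z) (fun _ => hz)
      ⟨fun _ => z, fun _ => by simp⟩
    have h := hy' 0
    simp only [Finset.univ_unique, Fin.default_eq_zero, Finset.sum_singleton] at h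
    have : z = y 0 := by
      apply cmap_ext
      intro k
      have := congrArg (cmap R I k) h
      simp only [map_smul, smul_eq_mul] at this
      exact (mul_left_cancel₀ hr this).symm
    rw [this]; exact hy 0
  choose e he1 he2 using aux_retract R hH hP I A hA'
  let B : ULift.{w} ℕ → Submodule R (⨁ n, ↥(I n)) := fun i =>
    trunc R I A (i.down + 1) ⊓ LinearMap.ker (e i.down)
  have hBA : ∀ i, B i ≤ A := fun i z hz => ((mem_trunc R I A _ _).1 hz.1).1
  let c : ∀ i, B i →ₗ[R] R := fun i => cmap R I i.down ∘ₗ (B i).subtype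
  have hc : ∀ i, Function.Injective (c i) := by
    intro i
    rw [injective_iff_map_eq_zero]
    intro z hz
    exact Subtype.ext (aux_inj R I A i.down (e i.down) (he2 _) z z.2.1 z.2.2 hz)
  let Φ : (⨁ i, ↥(B i)) →ₗ[R] A :=
    DirectSum.toModule R _ A fun i => Submodule.inclusion (hBA i)
  have hΦinj : Function.Injective Φ := by
    letI : AddCommGroup (⨁ i, ↥(B i)) := Module.addCommMonoidToAddCommGroup R
    rw [injective_iff_map_eq_zero]
    intro z hz
    by_contra hz0
    have hne : (DFinsupp.support z).Nonempty := by
      rw [Finset.nonempty_iff_ne_empty]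
      exact fun h => hz0 (DFinsupp.support_eq_empty.1 h)
    obtain ⟨i, hi, hmax⟩ := Finset.exists_max_image _ (fun i : ULift.{w} ℕ => i.down) hne
    have hsum : Φ z = ∑ j ∈ DFinsupp.support z, Submodule.inclusion (hBA j) (z j) := by
      conv_lhs => rw [← DirectSum.sum_support_of z]
      rw [map_sum]
      refine Finset.sum_congr rfl fun j _ => ?_
      exact DirectSum.toModule_lof R (M := fun i => ↥(B i))
        (φ := fun i => Submodule.inclusion (hBA i)) j (z j)
    have h0 : cmap R I i.down (Φ z : ⨁ n, ↥(I n)) = 0 := by rw [hz]; simp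
    rw [hsum, Submodule.coe_sum, map_sum, Finset.sum_eq_single i] at h0
    · have : z i = 0 := hc i (by rw [map_zero]; exact h0)
      exact (DFinsupp.mem_support_iff.1 hi) this
    · intro j hj hji
      have hlt : j.down < i.down := lt_of_le_of_ne (hmax j hj) fun h => hji (ULift.ext _ _ h)
      exact ((mem_trunc R I A _ _).1 (z j).2.1).2 _ hlt
    · intro h; exact absurd hi h
  have hrange : ∀ n, ∀ z (hz : z ∈ A), z ∈ trunc R I A n →
      (⟨z, hz⟩ : A) ∈ LinearMap.range Φ := by
    intro n
    induction n with
    | zero =>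
      intro z hz hz'
      have : (⟨z, hz⟩ : A) = 0 := by
        apply Subtype.ext
        apply cmap_ext
        intro k
        simpa using ((mem_trunc R I A 0 z).1 hz').2 k (Nat.zero_le k)
      rw [this]; exact Submodule.zero_mem _
    | succ n ih =>
      intro z hz hz'
      have hen := he1 n z
      have henA := ((mem_trunc R I A _ _).1 hen).1
      have hB : z - e n z ∈ B ⟨n⟩ := by
        refine ⟨Submodule.sub_mem _ hz' ?_, ?_⟩
        · rw [mem_trunc] at hen ⊢
          exact ⟨hen.1, fun i hi => hen.2 i (by change n + 1 ≤ i at hi; omega)⟩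
        · change e n (z - e n z) = 0
          rw [map_sub, he2 n _ hen, sub_self]
      have h2 : (⟨z - e n z, hBA _ hB⟩ : A) ∈ LinearMap.range Φ :=
        ⟨DirectSum.lof R _ (fun i => ↥(B i)) ⟨n⟩ ⟨_, hB⟩, DirectSum.toModule_lof R _ _⟩
      have h3 := Submodule.add_mem _ (ih _ henA hen) h2
      convert h3 using 1
      apply Subtype.ext
      simp
  have hΦsurj : Function.Surjective Φ := by
    rintro ⟨z, hz⟩
    obtain ⟨S, hS⟩ := cmap_fin R I z
    refine hrange (S.sup id + 1) z hz ((mem_trunc R I A _ _).2 ⟨hz, fun i hi => ?_⟩)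
    by_contra h
    have := Finset.le_sup (f := id) ((hS i).2 h)
    simp only [id] at this
    omega
  exact ⟨ULift.{w} ℕ, fun i => LinearMap.range (c i),
    ⟨(LinearEquiv.ofBijective Φ ⟨hΦinj, hΦsurj⟩).symm ≪≫ₗ
      DFinsupp.mapRange.linearEquiv fun i => LinearEquiv.ofInjective (c i) (hc i)⟩⟩

/-- over an h-local Prüfer domain, every pure submodule of a countable
direct sum of nonzero ideals is isomorphic to a direct sum of ideals. -/
theorem stmt3 (hH : IsHLocal R) (hP : IsPruefer R)
    (I : ℕ → Ideal R) (hI : ∀ n, I n ≠ ⊥)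
    (A : Submodule R (⨁ n, ↥(I n))) (hA : IsPureSub R A) :
    IsDirectSumOfIdeals R ↥A := by
  exact aux_main R hH hP I A hA
end

section
/- Let R be an h-local Prüfer domain. A countable rank, torsion-free R-module M is isomorphic to a direct sum of ideals of R if and only if every finite rank pure submodule of M is isomorphic to a direct sum of ideals of R. -/
open DirectSum Cardinal

universe u v w

variable (R : Type u) [CommRing R] [IsDomain R]

section helpers
set_option linter.unusedSectionVars false
variable {R}

lemma pruefer_two (hP : IsPruefer R) (a b : R) :
    ∃ t c d : R, (1 - t) * a = c * b ∧ t * b = d * a := by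
  classical
  have hfg : (Ideal.span {a, b} : Ideal R).FG := ⟨{a, b}, by simp⟩
  have hproj := hP _ hfg
  have ha : a ∈ (Ideal.span {a, b} : Ideal R) := Ideal.subset_span (by simp)
  have hb : b ∈ (Ideal.span {a, b} : Ideal R) := Ideal.subset_span (by simp)
  let a' : (Ideal.span {a, b} : Ideal R) := ⟨a, ha⟩
  let b' : (Ideal.span {a, b} : Ideal R) := ⟨b, hb⟩
  let p : R × R →ₗ[R] (Ideal.span {a, b} : Ideal R) :=
    (LinearMap.toSpanSingleton R _ a').coprod (LinearMap.toSpanSingleton R _ b')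
  have hp : Function.Surjective p := by
    rintro ⟨x, hx⟩
    obtain ⟨u, v, huv⟩ := Ideal.mem_span_pair.1 hx
    refine ⟨(u, v), ?_⟩
    apply Subtype.ext
    simpa [p, a', b'] using huv
  obtain ⟨s, hs⟩ := Module.projective_lifting_property p LinearMap.id hp
  have h1 : (s a').1 * a + (s a').2 * b = a := by
    have := congrArg Subtype.val (LinearMap.congr_fun hs a')
    simpa [p, a', b'] using this
  have h2 : b • s a' = a • s b' := by
    rw [← map_smul, ← map_smul]
    congr 1
    apply Subtype.ext
    simp [a', b', mul_comm]
  have h3 := congrArg Prod.fst h2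
  simp only [Prod.smul_fst, smul_eq_mul] at h3
  refine ⟨(s a').1, (s a').2, (s b').1, ?_, ?_⟩
  · linear_combination (1 : R) * (-h1)
  · linear_combination h3

lemma hlocal_half (hH : IsHLocal R) (m : Ideal R) (hm : m.IsMaximal) (I J : Ideal R)
    (x : R) (hx : x ≠ 0) (hxJ : x ∈ J) (hloc : ∀ a ∈ I, ∃ s, s ∉ m ∧ s * a ∈ J) :
    ∃ r, r ∉ m ∧ ∀ a ∈ I, r * a ∈ J := by
  classical
  have hsep : ∀ n : Ideal R, n.IsMaximal → n ≠ m → ∃ r s, r ∉ m ∧ s ∉ n ∧ x ∣ r * s := by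
    intro n hn hnm
    by_contra hcon
    push Not at hcon
    have hmp := hm.isPrime
    have hnp := hn.isPrime
    have hd : Disjoint ((Ideal.span {x} : Ideal R) : Set R)
        ((m.primeCompl ⊔ n.primeCompl : Submonoid R) : Set R) := by
      rw [Set.disjoint_left]
      intro y hy hy'
      obtain ⟨r, hr, s, hs, rfl⟩ := Submonoid.mem_sup.1 hy'
      exact hcon r s hr hs (Ideal.mem_span_singleton.1 hy)
    obtain ⟨P, hPp, hxP, hPd⟩ := Ideal.exists_le_prime_disjoint _ _ hd
    rw [Set.disjoint_left] at hPd
    have hP0 : P ≠ ⊥ := by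
      rintro rfl
      exact hx (by simpa using hxP (Ideal.mem_span_singleton_self x))
    obtain ⟨q, -, hq⟩ := hH.1 P hPp hP0
    have e1 : m = q := hq m ⟨hm, fun y hy => by
      by_contra hym
      exact hPd hy ((le_sup_left : m.primeCompl ≤ m.primeCompl ⊔ n.primeCompl) hym)⟩
    have e2 : n = q := hq n ⟨hn, fun y hy => by
      by_contra hym
      exact hPd hy ((le_sup_right : n.primeCompl ≤ m.primeCompl ⊔ n.primeCompl) hym)⟩
    exact hnm (e2.trans e1.symm)
  choose! r s hr hs hd using hsep
  have hfin : {n : Ideal R | n.IsMaximal ∧ x ∈ n}.Finite := hH.2 x hx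
  let S := hfin.toFinset.erase m
  have hS : ∀ n, n ∈ S ↔ n ≠ m ∧ n.IsMaximal ∧ x ∈ n := by intro n; simp [S]
  have hmp := hm.isPrime
  refine ⟨∏ n ∈ S, r n, ?_, ?_⟩
  · intro h
    obtain ⟨n, hn, hn'⟩ := (Ideal.IsPrime.prod_mem_iff (hp := hmp)).1 h
    have := (hS n).1 hn
    exact hr n this.2.1 this.1 hn'
  · intro a ha
    by_contra hcon
    let C : Ideal R := Submodule.comap (LinearMap.toSpanSingleton R R ((∏ n ∈ S, r n) * a)) J
    have hC : ∀ t, t ∈ C ↔ t * ((∏ n ∈ S, r n) * a) ∈ J := by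
      intro t; simp [C]
    have hCne : C ≠ ⊤ := by
      intro h
      apply hcon
      have : (1 : R) ∈ C := h ▸ Submodule.mem_top
      simpa [hC] using this
    obtain ⟨n, hn, hCn⟩ := Ideal.exists_le_maximal C hCne
    by_cases hnm : n = m
    · subst hnm
      obtain ⟨t, ht, htJ⟩ := hloc a ha
      apply ht
      apply hCn
      rw [hC]
      have := J.mul_mem_left (∏ n ∈ S, r n) htJ
      convert this using 1; ring
    by_cases hxn : x ∈ n
    · apply hs n hn hnm
      apply hCn
      rw [hC]
      have hnS : n ∈ S := (hS n).2 ⟨hnm, hn, hxn⟩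
      have : x ∣ s n * ((∏ n ∈ S, r n) * a) := by
        have h1 : r n ∣ ∏ n ∈ S, r n := Finset.dvd_prod_of_mem r hnS
        obtain ⟨c, hc⟩ := h1
        obtain ⟨d, hd'⟩ := hd n hn hnm
        exact ⟨d * c * a, by rw [hc]; linear_combination (c * a) * hd'⟩
      exact J.mem_of_dvd this hxJ
    · apply hxn
      apply hCn
      rw [hC]
      exact J.mul_mem_right _ hxJ

lemma ideal_key (hH : IsHLocal R) (hP : IsPruefer R) (I J : Ideal R) :
    ∃ α : R, (∀ a ∈ I, α * a ∈ J) ∧ (∀ b ∈ J, (1 - α) * b ∈ I) := by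
  by_cases hI : I = ⊥
  · subst hI; exact ⟨1, by simp, by simp⟩
  by_cases hJ : J = ⊥
  · subst hJ; exact ⟨0, by simp, by simp⟩
  obtain ⟨x, hxI, hx⟩ := Submodule.exists_mem_ne_zero_of_ne_bot hI
  obtain ⟨y, hyJ, hy⟩ := Submodule.exists_mem_ne_zero_of_ne_bot hJ
  let C (I J : Ideal R) : Ideal R := Submodule.colon J (I : Set R)
  have hC : ∀ I J : Ideal R, ∀ t, t ∈ C I J ↔ ∀ a ∈ I, t * a ∈ J := by
    intro I J t; simp [C, Submodule.mem_colon]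
  have hsup : C I J ⊔ C J I = ⊤ := by
    by_contra hne
    obtain ⟨m, hm, hle⟩ := Ideal.exists_le_maximal _ hne
    rw [sup_le_iff] at hle
    by_cases hloc : ∀ a ∈ I, ∃ s, s ∉ m ∧ s * a ∈ J
    · obtain ⟨r, hr, h⟩ := hlocal_half hH m hm I J y hy hyJ hloc
      exact hr (hle.1 ((hC _ _ _).2 h))
    · push Not at hloc
      obtain ⟨a, ha, hloc⟩ := hloc
      obtain ⟨r, hr, h⟩ := hlocal_half hH m hm J I x hx hxI (by
        intro b hb
        obtain ⟨t, c, d, h1, h2⟩ := pruefer_two hP a b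
        by_cases ht : t ∈ m
        · exfalso
          refine hloc (1 - t) ?_ ?_
          · intro h
            apply hm.ne_top
            rw [Ideal.eq_top_iff_one]
            simpa using m.add_mem h ht
          · rw [h1]; exact J.mul_mem_left _ hb
        · exact ⟨t, ht, by rw [h2]; exact I.mul_mem_left _ ha⟩)
      exact hr (hle.2 ((hC _ _ _).2 h))
  have h1 : (1 : R) ∈ C I J ⊔ C J I := hsup ▸ Submodule.mem_top
  obtain ⟨α, hα, β, hβ, hab⟩ := Submodule.mem_sup.1 h1
  refine ⟨α, (hC _ _ _).1 hα, ?_⟩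
  have : 1 - α = β := by rw [← hab]; ring
  rw [this]
  exact (hC _ _ _).1 hβ

/-- bounded denominators -/
def FrI (J : Submodule R (FractionRing R)) : Prop :=
  ∃ d : R, d ≠ 0 ∧ ∀ x ∈ J, ∃ r : R, algebraMap R (FractionRing R) r = d • x

lemma FrI.mono {J J' : Submodule R (FractionRing R)} (h : FrI J) (hle : J' ≤ J) : FrI J' := by
  obtain ⟨d, hd, h⟩ := h
  exact ⟨d, hd, fun x hx => h x (hle hx)⟩

lemma FrI.sup {J J' : Submodule R (FractionRing R)} (h : FrI J) (h' : FrI J') :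
    FrI (J ⊔ J') := by
  obtain ⟨d, hd, h⟩ := h
  obtain ⟨d', hd', h'⟩ := h'
  refine ⟨d * d', mul_ne_zero hd hd', fun x hx => ?_⟩
  obtain ⟨y, hy, z, hz, rfl⟩ := Submodule.mem_sup.1 hx
  obtain ⟨r, hr⟩ := h y hy
  obtain ⟨r', hr'⟩ := h' z hz
  refine ⟨d' * r + d * r', ?_⟩
  rw [map_add, map_mul, map_mul, hr, hr']
  simp only [Algebra.smul_def, map_mul]
  ring

/-- The ideal obtained by scaling. -/
def scaleIdeal (d : R) (J : Submodule R (FractionRing R)) : Ideal R :=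
  (J.map (LinearMap.lsmul R (FractionRing R) d)).comap (Algebra.linearMap R (FractionRing R))

lemma mem_scaleIdeal (d : R) (J : Submodule R (FractionRing R)) (r : R) :
    r ∈ scaleIdeal d J ↔ ∃ x ∈ J, d • x = algebraMap R (FractionRing R) r := by
  simp [scaleIdeal]

lemma smul_inj {d : R} (hd : d ≠ 0) {x y : FractionRing R} (h : d • x = d • y) : x = y := by
  rw [Algebra.smul_def, Algebra.smul_def] at h
  exact mul_left_cancel₀ (by simpa using hd) h

lemma FrI.equiv {J : Submodule R (FractionRing R)} (h : FrI J) :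
    ∃ I : Ideal R, Nonempty (J ≃ₗ[R] I) := by
  obtain ⟨d, hd, h⟩ := h
  choose! r hr using h
  refine ⟨scaleIdeal d J, ⟨LinearEquiv.ofBijective
    { toFun := fun x => ⟨r x, (mem_scaleIdeal d J _).2 ⟨x, x.2, (hr x x.2).symm⟩⟩
      map_add' := ?_, map_smul' := ?_ } ⟨?_, ?_⟩⟩⟩
  · intro x y
    apply Subtype.ext
    apply IsFractionRing.injective R (FractionRing R)
    simp [hr, smul_add, J.add_mem]
  · intro c x
    apply Subtype.ext
    apply IsFractionRing.injective R (FractionRing R)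
    have := hr (c • x : J) (c • x : J).2
    simp only [Submodule.coe_smul] at this
    simp only [Submodule.coe_smul, RingHom.id_apply, smul_eq_mul, map_mul]
    rw [this, hr x x.2]
    simp only [Algebra.smul_def]
    ring
  · intro x y hxy
    have h1 : r x = r y := congrArg Subtype.val hxy
    apply Subtype.ext
    apply smul_inj hd
    rw [← hr x x.2, ← hr y y.2, h1]
  · rintro ⟨c, hc⟩
    obtain ⟨x, hx, hxc⟩ := (mem_scaleIdeal d J _).1 hc
    refine ⟨⟨x, hx⟩, ?_⟩
    apply Subtype.ext
    apply IsFractionRing.injective R (FractionRing R)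
    simp [hr x hx, hxc]

lemma frac_key (hH : IsHLocal R) (hP : IsPruefer R) {J J' : Submodule R (FractionRing R)}
    (h : FrI J) (h' : FrI J') :
    ∃ α : R, (∀ a ∈ J, α • a ∈ J') ∧ (∀ b ∈ J', (1 - α) • b ∈ J) := by
  obtain ⟨d, hd, hs⟩ := h.sup h'
  obtain ⟨α, h1, h2⟩ := ideal_key hH hP (scaleIdeal d J) (scaleIdeal d J')
  have aux : ∀ (A B : Submodule R (FractionRing R)) (t : R), A ≤ J ⊔ J' →
      (∀ a ∈ scaleIdeal d A, t * a ∈ scaleIdeal d B) → ∀ a ∈ A, t • a ∈ B := by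
    intro A B t hA hyp a ha
    obtain ⟨r, hr⟩ := hs a (hA ha)
    obtain ⟨x, hx, hxr⟩ := (mem_scaleIdeal d B _).1
      (hyp r ((mem_scaleIdeal d A r).2 ⟨a, ha, hr.symm⟩))
    have : x = t • a := by
      apply smul_inj hd
      rw [hxr, map_mul, hr]
      simp only [Algebra.smul_def]
      ring
    exact this ▸ hx
  exact ⟨α, aux J J' α le_sup_left h1, aux J' J (1 - α) le_sup_right h2⟩

variable (R) in
/-- finite direct sum of ideals -/
def FinSum (N : Type*) [AddCommGroup N] [Module R N] : Prop :=
  ∃ (ι : Type) (_ : Finite ι) (I : ι → Ideal R), Nonempty (N ≃ₗ[R] (∀ i, I i))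

lemma FinSum.congr {N : Type*} [AddCommGroup N] [Module R N] {N' : Type*} [AddCommGroup N']
    [Module R N'] (e : N ≃ₗ[R] N') (h : FinSum R N) : FinSum R N' := by
  obtain ⟨ι, hι, I, ⟨f⟩⟩ := h
  exact ⟨ι, hι, I, ⟨e.symm.trans f⟩⟩

lemma FinSum.prod {N : Type*} [AddCommGroup N] [Module R N] {N' : Type*} [AddCommGroup N']
    [Module R N'] (h : FinSum R N) (h' : FinSum R N') : FinSum R (N × N') := by
  obtain ⟨ι, hι, I, ⟨f⟩⟩ := h
  obtain ⟨κ, hκ, I', ⟨f'⟩⟩ := h'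
  exact ⟨ι ⊕ κ, inferInstance, Sum.elim I I',
    ⟨(f.prodCongr f').trans
      (LinearEquiv.sumPiEquivProdPi R ι κ (fun i => ↥(Sum.elim I I' i))).symm⟩⟩

lemma FinSum.of_ideal (I : Ideal R) : FinSum R I :=
  ⟨Unit, inferInstance, fun _ => I, ⟨(LinearEquiv.funUnique Unit R I).symm⟩⟩

lemma FinSum.of_subsingleton {N : Type*} [AddCommGroup N] [Module R N] [Subsingleton N] :
    FinSum R N :=
  ⟨Empty, inferInstance, fun _ => ⊥, ⟨0, 0, fun _ => Subsingleton.elim _ _,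
    fun _ => Subsingleton.elim _ _⟩⟩

lemma FinSum.of_frI {J : Submodule R (FractionRing R)} (h : FrI J) : FinSum R J := by
  obtain ⟨I, ⟨e⟩⟩ := h.equiv
  exact (FinSum.of_ideal I).congr e.symm

variable (R) in
/-- splitting property -/
def SplitProp (G : Type*) [AddCommGroup G] [Module R G] : Prop :=
  ∀ f : G →ₗ[R] FractionRing R, FrI (LinearMap.range f) ∧ FinSum R (LinearMap.ker f) ∧
    ∃ s : LinearMap.range f →ₗ[R] G, ∀ x, f (s x) = x

lemma SplitProp.of_subsingleton {G : Type*} [AddCommGroup G] [Module R G] [Subsingleton G] :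
    SplitProp R G := by
  intro f
  have hf : ∀ x, f x = 0 := fun x => by rw [Subsingleton.elim x 0, map_zero]
  refine ⟨⟨1, one_ne_zero, ?_⟩, FinSum.of_subsingleton, 0, ?_⟩
  · rintro _ ⟨x, rfl⟩
    exact ⟨0, by simp [hf]⟩
  · rintro ⟨_, x, rfl⟩
    simp [hf]

lemma SplitProp.congr {N : Type*} [AddCommGroup N] [Module R N] {N' : Type*} [AddCommGroup N']
    [Module R N'] (e : N ≃ₗ[R] N') (h : SplitProp R N) : SplitProp R N' := by
  intro f
  obtain ⟨h1, h2, s, hs⟩ := h (f ∘ₗ e.toLinearMap)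
  have hr : LinearMap.range (f ∘ₗ e.toLinearMap) = LinearMap.range f := by
    rw [LinearMap.range_comp_of_range_eq_top]; exact e.range
  rw [hr] at h1
  refine ⟨h1, ?_, e.toLinearMap ∘ₗ s ∘ₗ (LinearEquiv.ofEq _ _ hr.symm).toLinearMap, ?_⟩
  · refine h2.congr (LinearEquiv.ofSubmodules e _ _ ?_)
    ext x
    simp only [Submodule.mem_map, LinearMap.mem_ker, LinearMap.comp_apply]
    constructor
    · rintro ⟨y, hy, rfl⟩; exact hy
    · intro hx; exact ⟨e.symm x, by simpa using hx, by simp⟩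
  · intro x
    exact hs (LinearEquiv.ofEq _ _ hr.symm x)

lemma SplitProp.of_ideal (I : Ideal R) : SplitProp R I := by
  intro f
  by_cases hf : f = 0
  · subst hf
    refine ⟨⟨1, one_ne_zero, ?_⟩, ?_, 0, ?_⟩
    · rintro _ ⟨x, rfl⟩
      exact ⟨0, by simp⟩
    · exact (FinSum.of_ideal I).congr ((LinearEquiv.ofTop _ (by simp)).symm)
    · rintro ⟨_, x, rfl⟩
      simp
  obtain ⟨a, ha⟩ : ∃ a, f a ≠ 0 := by
    by_contra h; push Not at h; exact hf (LinearMap.ext h)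
  have ha0 : (a : R) ≠ 0 := by
    intro h
    apply ha
    have : a = 0 := Subtype.ext h
    rw [this, map_zero]
  have hcomm : ∀ b : I, (b : R) • f a = (a : R) • f b := by
    intro b
    rw [← map_smul, ← map_smul]
    congr 1
    apply Subtype.ext
    simp [mul_comm]
  have hinj : Function.Injective f := by
    rw [← LinearMap.ker_eq_bot, LinearMap.ker_eq_bot']
    intro b hb
    have := hcomm b
    rw [hb, smul_zero, Algebra.smul_def] at this
    rcases mul_eq_zero.1 this with h | h
    · apply Subtype.ext; simpa using h
    · exact absurd h ha
  refine ⟨?_, ?_, ?_⟩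
  · obtain ⟨u, v, hv, huv⟩ := IsFractionRing.div_surjective (A := R) (f a)
    have hv0 : v ≠ 0 := nonZeroDivisors.ne_zero hv
    refine ⟨v * a, mul_ne_zero hv0 ha0, ?_⟩
    rintro _ ⟨b, rfl⟩
    refine ⟨b * u, ?_⟩
    rw [mul_smul, ← hcomm, ← huv]
    have : algebraMap R (FractionRing R) v ≠ 0 := by simpa using hv0
    simp only [Algebra.smul_def, map_mul]
    field_simp
  · have : Subsingleton (LinearMap.ker f) := by
      rw [LinearMap.ker_eq_bot.2 hinj]; infer_instance
    exact FinSum.of_subsingleton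
  · refine ⟨(LinearEquiv.ofInjective f hinj).symm.toLinearMap, fun x => ?_⟩
    obtain ⟨y, rfl⟩ := (LinearEquiv.ofInjective f hinj).surjective x
    simp

lemma SplitProp.prod (hH : IsHLocal R) (hP : IsPruefer R)
    {G : Type*} [AddCommGroup G] [Module R G] {G' : Type*} [AddCommGroup G']
    [Module R G'] (h : SplitProp R G) (h' : SplitProp R G') : SplitProp R (G × G') := by
  intro f
  set f₁ := f ∘ₗ LinearMap.inl R G G' with hf₁
  set f₂ := f ∘ₗ LinearMap.inr R G G' with hf₂
  have hf : ∀ x y, f (x, y) = f₁ x + f₂ y := by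
    intro x y
    rw [hf₁, hf₂]
    simp [← map_add]
  obtain ⟨hJ₁, hk₁, s₁, hs₁⟩ := h f₁
  obtain ⟨hJ₂, hk₂, s₂, hs₂⟩ := h' f₂
  obtain ⟨α, hα, hα'⟩ := frac_key hH hP hJ₁ hJ₂
  have hle : LinearMap.range f ≤ LinearMap.range f₁ ⊔ LinearMap.range f₂ := by
    rintro _ ⟨⟨x, y⟩, rfl⟩
    rw [hf]
    exact Submodule.add_mem_sup ⟨x, rfl⟩ ⟨y, rfl⟩
  have hm₁ : ∀ z ∈ LinearMap.range f, (1 - α) • z ∈ LinearMap.range f₁ := by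
    rintro _ ⟨⟨x, y⟩, rfl⟩
    rw [hf, smul_add]
    exact Submodule.add_mem _ (Submodule.smul_mem _ _ ⟨x, rfl⟩) (hα' _ ⟨y, rfl⟩)
  have hm₂ : ∀ z ∈ LinearMap.range f, α • z ∈ LinearMap.range f₂ := by
    rintro _ ⟨⟨x, y⟩, rfl⟩
    rw [hf, smul_add]
    exact Submodule.add_mem _ (hα _ ⟨x, rfl⟩) (Submodule.smul_mem _ _ ⟨y, rfl⟩)
  refine ⟨(hJ₁.sup hJ₂).mono hle, ?_, ?_⟩
  · -- the kernel
    have hfin : FinSum R ((LinearMap.ker f₁ × LinearMap.ker f₂) ×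
        (LinearMap.range f₁ ⊓ LinearMap.range f₂ : Submodule R (FractionRing R))) :=
      (hk₁.prod hk₂).prod (FinSum.of_frI (hJ₁.mono inf_le_left))
    let i₁ : (LinearMap.range f₁ ⊓ LinearMap.range f₂ : Submodule R (FractionRing R)) →ₗ[R]
      LinearMap.range f₁ := Submodule.inclusion inf_le_left
    let i₂ : (LinearMap.range f₁ ⊓ LinearMap.range f₂ : Submodule R (FractionRing R)) →ₗ[R]
      LinearMap.range f₂ := Submodule.inclusion inf_le_right
    have hsi₁ : ∀ z, f₁ (s₁ (i₁ z)) = z := fun z => hs₁ _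
    have hsi₂ : ∀ z, f₂ (s₂ (i₂ z)) = z := fun z => hs₂ _
    let F : ((LinearMap.ker f₁ × LinearMap.ker f₂) ×
        (LinearMap.range f₁ ⊓ LinearMap.range f₂ : Submodule R (FractionRing R))) →ₗ[R] G × G' :=
      ((Submodule.subtype _).prodMap (Submodule.subtype _)).coprod
        ((s₁ ∘ₗ i₁).prod (-(s₂ ∘ₗ i₂)))
    have hF : ∀ a b z, F ((a, b), z) = ((a : G) + s₁ (i₁ z), (b : G') - s₂ (i₂ z)) := by
      intro a b z; simp [F, sub_eq_add_neg]
    have hFinj : Function.Injective F := by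
      rw [← LinearMap.ker_eq_bot, LinearMap.ker_eq_bot']
      rintro ⟨⟨⟨a, ha⟩, ⟨b, hb⟩⟩, z⟩ h0
      rw [hF] at h0
      have h1 := congrArg Prod.fst h0
      have h2 := congrArg Prod.snd h0
      simp only [Prod.fst_zero, Prod.snd_zero] at h1 h2
      have h3 : z = 0 := by
        apply Subtype.ext
        have := congrArg f₁ h1
        rw [map_add, hsi₁, LinearMap.mem_ker.1 ha, map_zero, zero_add] at this
        exact this
      subst h3
      simp only [map_zero, add_zero, sub_zero] at h1 h2
      subst h1 h2
      rfl
    have hFr : LinearMap.range F = LinearMap.ker f := by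
      apply le_antisymm
      · rintro _ ⟨⟨⟨⟨a, ha⟩, ⟨b, hb⟩⟩, z⟩, rfl⟩
        rw [hF, LinearMap.mem_ker, hf, map_add, map_sub, hsi₁, hsi₂, LinearMap.mem_ker.1 ha,
          LinearMap.mem_ker.1 hb]
        simp
      · rintro ⟨x, y⟩ hxy
        rw [LinearMap.mem_ker, hf] at hxy
        have hz : f₁ x ∈ (LinearMap.range f₁ ⊓ LinearMap.range f₂ :
            Submodule R (FractionRing R)) :=
          ⟨⟨x, rfl⟩, ⟨-y, by rw [map_neg]; linear_combination -hxy⟩⟩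
        refine ⟨((⟨x - s₁ (i₁ ⟨_, hz⟩), ?_⟩, ⟨y + s₂ (i₂ ⟨_, hz⟩), ?_⟩), ⟨_, hz⟩), ?_⟩
        · rw [LinearMap.mem_ker, map_sub, hsi₁]; simp
        · rw [LinearMap.mem_ker, map_add, hsi₂]; linear_combination hxy
        · rw [hF]; simp
    exact hfin.congr ((LinearEquiv.ofInjective F hFinj).trans (LinearEquiv.ofEq _ _ hFr))
  · let t₁ : LinearMap.range f →ₗ[R] LinearMap.range f₁ :=
      LinearMap.codRestrict _ ((1 - α) • Submodule.subtype _) (fun z => hm₁ z z.2)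
    let t₂ : LinearMap.range f →ₗ[R] LinearMap.range f₂ :=
      LinearMap.codRestrict _ (α • Submodule.subtype _) (fun z => hm₂ z z.2)
    refine ⟨(s₁ ∘ₗ t₁).prod (s₂ ∘ₗ t₂), fun z => ?_⟩
    have e1 : f (((s₁ ∘ₗ t₁).prod (s₂ ∘ₗ t₂)) z) = f (s₁ (t₁ z), s₂ (t₂ z)) := rfl
    have e2 : (t₁ z : FractionRing R) = (1 - α) • (z : FractionRing R) := rfl
    have e3 : (t₂ z : FractionRing R) = α • (z : FractionRing R) := rfl
    rw [e1, hf, hs₁, hs₂, e2, e3, ← add_smul]; simp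

lemma FinSum.splitProp (hH : IsHLocal R) (hP : IsPruefer R)
    {G : Type*} [AddCommGroup G] [Module R G] (h : FinSum R G) : SplitProp R G := by
  obtain ⟨ι, hι, I, ⟨e⟩⟩ := h
  refine SplitProp.congr e.symm ?_
  clear e
  obtain ⟨n, ⟨e⟩⟩ := Finite.exists_equiv_fin ι
  refine SplitProp.congr (LinearEquiv.piCongrLeft R (fun i => I i) e.symm) ?_
  suffices H : ∀ I' : Fin n → Ideal R, SplitProp R (∀ i, I' i) from H (fun i => I (e.symm i))
  clear e hι I
  intro I'
  induction n with
  | zero => exact SplitProp.of_subsingleton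
  | succ n ih =>
    exact SplitProp.congr (Fin.consLinearEquiv R (fun i => ↥(I' i)))
      (SplitProp.prod hH hP (SplitProp.of_ideal _) (ih (fun i => I' i.succ)))

lemma FinSum.iInf_ker (hH : IsHLocal R) (hP : IsPruefer R) {n : ℕ} :
    ∀ {G : Type v} [AddCommGroup G] [Module R G] (_ : FinSum R G)
      (f : G →ₗ[R] (Fin n → FractionRing R)), FinSum R (LinearMap.ker f) := by
  induction n with
  | zero =>
    intro G _ _ h f
    exact h.congr ((LinearEquiv.ofTop _ (by
      ext x; simp [Subsingleton.elim (f x) 0])).symm)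
  | succ n ih =>
    intro G _ _ h f
    have hk := (h.splitProp hH hP ((LinearMap.proj 0) ∘ₗ f)).2.1
    set k := LinearMap.ker ((LinearMap.proj 0) ∘ₗ f)
    have := ih hk ((LinearMap.funLeft R (FractionRing R) Fin.succ) ∘ₗ f ∘ₗ k.subtype)
    refine this.congr ?_
    refine (LinearEquiv.ofInjective (k.subtype ∘ₗ Submodule.subtype _)
      (Subtype.val_injective.comp Subtype.val_injective)).trans (LinearEquiv.ofEq _ _ ?_)
    ext x
    simp only [LinearMap.mem_range, LinearMap.mem_ker]
    constructor
    · rintro ⟨⟨⟨y, hy⟩, hy'⟩, rfl⟩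
      have hy0 : f y 0 = 0 := hy
      have hy1 : ∀ i : Fin n, f y i.succ = 0 := fun i => congrFun hy' i
      ext i
      refine Fin.cases ?_ ?_ i
      · exact hy0
      · exact hy1
    · intro hx
      refine ⟨⟨⟨x, ?_⟩, ?_⟩, rfl⟩
      · change f x 0 = 0
        rw [hx]; rfl
      · ext i
        change f x i.succ = 0
        rw [hx]; rfl

lemma FinSum.of_pi {σ : Type*} [Finite σ] (I : σ → Ideal R) : FinSum R (∀ i, I i) := by
  obtain ⟨n, ⟨e⟩⟩ := Finite.exists_equiv_fin σ
  exact ⟨Fin n, inferInstance, fun i => I (e.symm i),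
    ⟨(LinearEquiv.piCongrLeft R (fun i => I i) e.symm).symm⟩⟩

lemma FinSum.isDirectSum {N : Type v} [AddCommGroup N] [Module R N] (h : FinSum R N) :
    IsDirectSumOfIdeals.{u, v, w} R N := by
  obtain ⟨ι, hι, I, ⟨f⟩⟩ := h
  have := Fintype.ofFinite ι
  refine ⟨ULift.{w} ι, fun i => I i.down, ⟨?_⟩⟩
  exact (f.trans (LinearEquiv.piCongrLeft R (fun i => I i) Equiv.ulift).symm).trans
    (DirectSum.linearEquivFunOnFintype R (ULift.{w} ι) (fun i => I i.down)).symm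

lemma exists_embed (M : Type v) [AddCommGroup M] [Module R M]
    (htf : ∀ (r : R) (x : M), r • x = 0 → r = 0 ∨ x = 0) :
    ∃ (ι : Type (max u v)) (φ : M →ₗ[R] (ι →₀ FractionRing R)), Function.Injective φ ∧
      #ι = Cardinal.lift.{u} (Module.rank R M) := by
  let V := LocalizedModule (nonZeroDivisors R) M
  let j : M →ₗ[R] V := LocalizedModule.mkLinearMap (nonZeroDivisors R) M
  have hr : Module.rank (FractionRing R) V = Cardinal.lift.{u} (Module.rank R M) := by
    rw [IsLocalization.rank_eq (FractionRing R) (nonZeroDivisors R) le_rfl]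
    have := IsLocalizedModule.lift_rank_eq (nonZeroDivisors R) j le_rfl
    rw [Cardinal.lift_id'.{v, max u v}] at this
    rw [this, Cardinal.lift_umax.{v, u}]
  let b := Module.Basis.ofVectorSpace (FractionRing R) V
  refine ⟨_, (b.repr.toLinearMap.restrictScalars R) ∘ₗ j, ?_, ?_⟩
  · refine b.repr.injective.comp ?_
    rw [← LinearMap.ker_eq_bot, LinearMap.ker_eq_bot']
    intro x hx
    obtain ⟨s, hs⟩ := (IsLocalizedModule.eq_zero_iff (nonZeroDivisors R) j).1 hx
    exact (htf s x hs).resolve_left (nonZeroDivisors.coe_ne_zero s)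
  · rw [b.mk_eq_rank'', hr]

lemma exists_embed_fin (M : Type v) [AddCommGroup M] [Module R M]
    (htf : ∀ (r : R) (x : M), r • x = 0 → r = 0 ∨ x = 0) (hr : Module.rank R M < ℵ₀) :
    ∃ (n : ℕ) (φ : M →ₗ[R] (Fin n → FractionRing R)), Function.Injective φ := by
  obtain ⟨ι, φ, hφ, hι⟩ := exists_embed M htf
  have hfin : Finite ι := by
    rw [← Cardinal.lt_aleph0_iff_finite, hι]
    simpa using hr
  obtain ⟨n, ⟨e⟩⟩ := Finite.exists_equiv_fin ι
  refine ⟨n, (LinearEquiv.funCongrLeft R (FractionRing R) e.symm).toLinearMap ∘ₗ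
    (Finsupp.linearEquivFunOnFinite R (FractionRing R) ι).toLinearMap ∘ₗ φ, ?_⟩
  exact (LinearEquiv.funCongrLeft R (FractionRing R) e.symm).injective.comp
    ((Finsupp.linearEquivFunOnFinite R (FractionRing R) ι).injective.comp hφ)

lemma exists_embed_nat (M : Type v) [AddCommGroup M] [Module R M]
    (htf : ∀ (r : R) (x : M), r • x = 0 → r = 0 ∨ x = 0) (hr : Module.rank R M ≤ ℵ₀) :
    ∃ (φ : M →ₗ[R] (ℕ →₀ FractionRing R)), Function.Injective φ := by
  obtain ⟨ι, φ, hφ, hι⟩ := exists_embed M htf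
  have hc : Countable ι := by
    rw [← Cardinal.mk_le_aleph0_iff, hι]
    simpa using hr
  obtain ⟨g, hg⟩ := exists_injective_nat ι
  exact ⟨Finsupp.lmapDomain (FractionRing R) R g ∘ₗ φ, (Finsupp.mapDomain_injective hg).comp hφ⟩

lemma FinSum.of_saturated (hH : IsHLocal R) (hP : IsPruefer R)
    {G : Type v} [AddCommGroup G] [Module R G] (hG : FinSum R G) (hr : Module.rank R G < ℵ₀)
    (A : Submodule R G) (hA : ∀ (r : R) (y : G), r ≠ 0 → r • y ∈ A → y ∈ A) : FinSum R A := by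
  obtain ⟨n, φ, hφ⟩ := exists_embed_fin (R := R) (G ⧸ A) (by
    intro r x hx
    by_cases h : r = 0
    · exact Or.inl h
    · right
      obtain ⟨y, rfl⟩ := A.mkQ_surjective x
      rw [← map_smul] at hx
      simp only [Submodule.mkQ_apply, Submodule.Quotient.mk_eq_zero] at hx ⊢
      exact hA r y h hx) ((rank_quotient_le A).trans_lt hr)
  have := hG.iInf_ker hH hP (φ ∘ₗ A.mkQ)
  refine this.congr (LinearEquiv.ofEq _ _ ?_)
  rw [LinearMap.ker_comp_of_ker_eq_bot _ (LinearMap.ker_eq_bot.2 hφ), Submodule.ker_mkQ]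

lemma exists_finite_dense {N : Type v} [AddCommGroup N] [Module R N]
    (hr : Module.rank R N < ℵ₀) :
    ∃ t : Set N, t.Finite ∧ ∀ x : N, ∃ r : R, r ≠ 0 ∧ r • x ∈ Submodule.span R t := by
  obtain ⟨t, ht, hli⟩ := exists_set_linearIndependent R N
  refine ⟨t, ?_, ?_⟩
  · rw [← Cardinal.lt_aleph0_iff_set_finite, ht]; exact hr
  have h1 := Submodule.rank_quotient_add_rank (Submodule.span R t)
  rw [rank_span_set hli, ht] at h1
  have h2 : Module.rank R (N ⧸ Submodule.span R t) = 0 := by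
    apply Cardinal.eq_of_add_eq_add_right _ hr
    rw [h1, zero_add]
  rw [rank_eq_zero_iff] at h2
  intro x
  obtain ⟨a, ha, hax⟩ := h2 (Submodule.Quotient.mk x)
  refine ⟨a, ha, ?_⟩
  rwa [← Submodule.Quotient.mk_smul, Submodule.Quotient.mk_eq_zero] at hax

lemma finSum_of_embed (hH : IsHLocal R) (hP : IsPruefer R)
    {N : Type v} [AddCommGroup N] [Module R N] (hr : Module.rank R N < ℵ₀)
    {ι : Type w} (I : ι → Ideal R) (e : N →ₗ[R] ⨁ i, ↥(I i)) (he : Function.Injective e)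
    (hsat : ∀ (r : R) y, r ≠ 0 → r • y ∈ LinearMap.range e → y ∈ LinearMap.range e) :
    FinSum R N := by
  classical
  obtain ⟨t, ht, hdense⟩ := exists_finite_dense hr
  let σ : Finset ι := ht.toFinset.biUnion (fun x => DFinsupp.support (e x))
  have hσ : ∀ (a : N) (i : ι), i ∉ σ → e a i = 0 := by
    intro a i hi
    obtain ⟨r, hr0, hra⟩ := hdense a
    have hle : Submodule.span R t ≤
        LinearMap.ker (DirectSum.component R ι (fun i => ↥(I i)) i ∘ₗ e) := by
      rw [Submodule.span_le]
      intro x hx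
      change e x i = 0
      by_contra hne
      apply hi
      simp only [σ, Finset.mem_biUnion]
      exact ⟨x, by simpa using hx, by simpa using hne⟩
    have h0 : e (r • a) i = 0 := hle hra
    rw [map_smul] at h0
    have h1 : r • (e a i) = 0 := h0
    have h2 := congrArg Subtype.val h1
    simp only [Submodule.coe_smul, smul_eq_mul, Submodule.coe_zero, mul_eq_zero] at h2
    exact Subtype.ext (h2.resolve_left hr0)
  let π : N →ₗ[R] (∀ i : σ, I i) :=
    LinearMap.pi (fun i => DirectSum.component R ι (fun i => ↥(I i)) i ∘ₗ e)
  have hπ : ∀ a i, π a i = e a i := fun a i => rfl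
  have hπinj : Function.Injective π := by
    rw [← LinearMap.ker_eq_bot, LinearMap.ker_eq_bot']
    intro a ha
    apply he
    rw [map_zero]
    refine DFinsupp.ext (fun i => ?_)
    by_cases hi : i ∈ σ
    · exact congrFun ha ⟨i, hi⟩
    · exact hσ a i hi
  have hrG : Module.rank R (∀ i : σ, I i) < ℵ₀ := by
    let inc : (∀ i : σ, I i) →ₗ[R] (σ → R) :=
      LinearMap.pi (fun i => (I i).subtype ∘ₗ LinearMap.proj i)
    have hinc : Function.Injective inc := by
      intro x y hxy
      funext i
      exact Subtype.ext (congrFun hxy i)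
    have h1 := LinearMap.rank_le_of_injective inc hinc
    exact h1.trans_lt (Module.rank_lt_aleph0 R _)
  have := (FinSum.of_pi (fun i : σ => I i)).of_saturated hH hP hrG (LinearMap.range π) (by
    rintro r y hr0 ⟨a, ha⟩
    let z : ⨁ i, ↥(I i) := DirectSum.mk (fun i => ↥(I i)) σ y
    have hz : r • z = e a := by
      refine DFinsupp.ext (fun i => ?_)
      by_cases hi : i ∈ σ
      · change r • z i = e a i
        have : z i = y ⟨i, hi⟩ := DirectSum.mk_apply_of_mem hi
        rw [this]
        exact (congrFun ha ⟨i, hi⟩).symm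
      · change r • z i = e a i
        have : z i = 0 := DirectSum.mk_apply_of_notMem hi
        rw [this, hσ a i hi, smul_zero]
    obtain ⟨b, hb⟩ := hsat r z hr0 ⟨a, hz.symm⟩
    refine ⟨b, ?_⟩
    funext i
    rw [hπ, hb]
    exact DirectSum.mk_apply_of_mem i.2)
  exact this.congr (LinearEquiv.ofInjective π hπinj).symm

lemma FrI.of_fg (J : Submodule R (FractionRing R)) (hJ : J.FG) : FrI J := by
  refine Submodule.fg_induction (motive := fun J _ => FrI J) ?_ ?_ J hJ
  · intro q
    obtain ⟨u, v, hv, rfl⟩ := IsFractionRing.div_surjective (A := R) q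
    have hv0 : v ≠ 0 := nonZeroDivisors.ne_zero hv
    have : algebraMap R (FractionRing R) v ≠ 0 := by simpa using hv0
    refine ⟨v, hv0, fun x hx => ?_⟩
    obtain ⟨c, rfl⟩ := Submodule.mem_span_singleton.1 hx
    refine ⟨c * u, ?_⟩
    simp only [Algebra.smul_def, map_mul]
    field_simp
  · intro N₁ N₂ _ _ h1 h2
    exact h1.sup h2

lemma fg_section (hP : IsPruefer R) {N : Type v} [AddCommGroup N] [Module R N]
    [Module.Finite R N] (g : N →ₗ[R] FractionRing R) :
    ∃ s : LinearMap.range g →ₗ[R] N, ∀ x, g (s x) = x := by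
  have hfg : (LinearMap.range g).FG := Module.Finite.fg_top.map g |> fun h => by
    rwa [Submodule.map_top] at h
  obtain ⟨I, ⟨e⟩⟩ := (FrI.of_fg _ hfg).equiv
  have : Module.Finite R (LinearMap.range g) := Module.Finite.iff_fg.2 hfg
  have hI : Module.Finite R I := Module.Finite.equiv e
  have := hP I (Module.Finite.iff_fg.1 hI)
  have : Module.Projective R (LinearMap.range g) := Module.Projective.of_equiv e.symm
  obtain ⟨s, hs⟩ := Module.projective_lifting_property g.rangeRestrict LinearMap.id
    g.surjective_rangeRestrict
  exact ⟨s, fun x => congrArg Subtype.val (LinearMap.congr_fun hs x)⟩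

lemma fg_proj (hP : IsPruefer R) {N : Type v} [AddCommGroup N] [Module R N]
    [Module.Finite R N] (f : ℕ → N →ₗ[R] FractionRing R) (s : Finset ℕ) :
    ∃ π : N →ₗ[R] N, (∀ x, ∀ i ∈ s, f i (π x) = 0) ∧ ∀ x, (∀ i ∈ s, f i x = 0) → π x = x := by
  classical
  induction s using Finset.induction_on with
  | empty => exact ⟨LinearMap.id, by simp, by simp⟩
  | insert j s hj ih =>
    obtain ⟨π, h1, h2⟩ := ih
    obtain ⟨σ, hσ⟩ := fg_section hP (f j ∘ₗ π)
    have hσ' : ∀ x, f j (π (σ x)) = x := hσ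
    let ρ := (f j ∘ₗ π).rangeRestrict
    have hρ : ∀ x, (ρ x : FractionRing R) = f j (π x) := fun x => rfl
    refine ⟨π ∘ₗ (LinearMap.id - σ ∘ₗ ρ), ?_, ?_⟩
    · intro x i hi
      simp only [LinearMap.comp_apply, LinearMap.sub_apply, LinearMap.id_apply]
      rcases Finset.mem_insert.1 hi with rfl | hi
      · rw [map_sub, map_sub, hσ', hρ, sub_self]
      · exact h1 _ i hi
    · intro x hx
      have hπx : π x = x := h2 x (fun i hi => hx i (Finset.mem_insert_of_mem hi))
      have hρ0 : ρ x = 0 := by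
        apply Subtype.ext
        rw [hρ, hπx, hx j (Finset.mem_insert_self _ _)]; rfl
      simp only [LinearMap.comp_apply, LinearMap.sub_apply, LinearMap.id_apply, hρ0, map_zero,
        sub_zero, hπx]

lemma pure_of_coords (hP : IsPruefer R) {M : Type v} [AddCommGroup M] [Module R M]
    (φ : M →ₗ[R] (ℕ →₀ FractionRing R)) (T : Set ℕ) (A : Submodule R M)
    (hA : ∀ x, x ∈ A ↔ ∀ i ∈ T, φ x i = 0) : IsPureSub R A := by
  classical
  rintro n m r a ha ⟨x, hx⟩
  let N := Submodule.span R (Set.range x)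
  have hNfin : Module.Finite R N := Module.Finite.span_of_finite R (Set.finite_range x)
  let s : Finset ℕ := Finset.univ.biUnion (fun j => (φ (x j)).support)
  have hs : ∀ i ∉ s, ∀ y ∈ N, φ y i = 0 := by
    intro i hi y hy
    have hle : N ≤ LinearMap.ker (Finsupp.lapply (R := R) i ∘ₗ φ) := by
      rw [Submodule.span_le]
      rintro _ ⟨j, rfl⟩
      change φ (x j) i = 0
      by_contra hne
      exact hi (Finset.mem_biUnion.2 ⟨j, Finset.mem_univ _, by simpa using hne⟩)
    exact hle hy
  obtain ⟨π, h1, h2⟩ := fg_proj hP (N := N)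
    (fun i => Finsupp.lapply (R := R) i ∘ₗ φ ∘ₗ N.subtype) (s.filter (· ∈ T))
  have hxN : ∀ j, x j ∈ N := fun j => Submodule.subset_span ⟨j, rfl⟩
  refine ⟨fun j => (π ⟨x j, hxN j⟩ : M), fun j => ?_, fun i => ?_⟩
  · rw [hA]
    intro i hi
    by_cases his : i ∈ s
    · exact h1 ⟨x j, hxN j⟩ i (by simp [his, hi])
    · exact hs i his _ (π ⟨x j, hxN j⟩).2
  · have haN : a i ∈ N := by
      rw [← hx i]
      exact Submodule.sum_mem _ (fun j _ => Submodule.smul_mem _ _ (hxN j))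
    have e1 : π ⟨a i, haN⟩ = ⟨a i, haN⟩ := by
      apply h2
      intro k hk
      exact (hA _).1 (ha i) k (Finset.mem_filter.1 hk).2
    have e2 : (⟨a i, haN⟩ : N) = ∑ j, r i j • (⟨x j, hxN j⟩ : N) := by
      apply Subtype.ext
      simp [hx i]
    have e3 := congrArg (Subtype.val) e1
    rw [e2, map_sum] at e3
    simp only [map_smul] at e3
    rw [← e2] at e3
    simpa using e3

lemma assemble {M : Type v} [AddCommGroup M] [Module R M]
    (φ : M →ₗ[R] (ℕ →₀ FractionRing R)) (hφ : Function.Injective φ)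
    (I : ℕ → Ideal R) (τ : ∀ n, I n →ₗ[R] M)
    (h1 : ∀ n x i, n < i → φ (τ n x) i = 0)
    (h2 : ∀ n x, φ (τ n x) n = 0 → x = 0)
    (h3 : ∀ n m, (∀ i, n < i → φ m i = 0) → ∃ x, φ (τ n x) n = φ m n) :
    IsDirectSumOfIdeals.{u, v, w} R M := by
  classical
  let Ψ : (⨁ i : ULift.{w} ℕ, ↥(I i.down)) →ₗ[R] M :=
    DirectSum.toModule R _ M (fun i => τ i.down)
  have hΨ : ∀ i x, Ψ (DirectSum.lof R (ULift.{w} ℕ) (fun i => ↥(I i.down)) i x) = τ i.down x :=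
    fun i x => DirectSum.toModule_lof (R := R) (ι := ULift.{w} ℕ) (M := fun i => ↥(I i.down))
      (φ := fun i => τ i.down) i x
  have hinj : Function.Injective Ψ := by
    rw [← LinearMap.ker_eq_bot, LinearMap.ker_eq_bot']
    intro z hz
    by_contra hne
    have hsupp : (DFinsupp.support z).Nonempty := by
      rw [Finset.nonempty_iff_ne_empty]
      intro h
      exact hne (DFinsupp.support_eq_empty.1 h)
    obtain ⟨n, hn, hmax⟩ := Finset.exists_max_image (DFinsupp.support z) (fun i => i.down) hsupp
    have hzsum := DirectSum.sum_support_of z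
    have e1 : φ (Ψ z) n.down = φ (τ n.down (z n)) n.down := by
      conv_lhs => rw [← hzsum]
      rw [map_sum, map_sum, Finsupp.finsetSum_apply, Finset.sum_eq_single n]
      · exact congrArg (fun y => φ y n.down) (hΨ n (z n))
      · intro j hj hjn
        have : φ (Ψ (DirectSum.lof R (ULift.{w} ℕ) (fun i => ↥(I i.down)) j (z j))) n.down
            = 0 := by
          rw [hΨ]
          apply h1
          refine lt_of_le_of_ne (hmax j hj) ?_
          intro h
          exact hjn (ULift.ext _ _ h)
        exact this
      · intro h; exact absurd hn h
    rw [hz, map_zero] at e1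
    have := h2 _ _ e1.symm
    exact (DFinsupp.mem_support_toFun z n).1 hn this
  have hsurj : ∀ n m, (∀ i, n ≤ i → φ m i = 0) → m ∈ LinearMap.range Ψ := by
    intro n
    induction n with
    | zero =>
      intro m hm
      have : m = 0 := by
        apply hφ
        ext i
        rw [hm i (Nat.zero_le _), map_zero]; rfl
      rw [this]; exact Submodule.zero_mem _
    | succ n ih =>
      intro m hm
      obtain ⟨x, hx⟩ := h3 n m (fun i hi => hm i hi)
      have hmem : m - τ n x ∈ LinearMap.range Ψ := by
        apply ih
        intro i hi
        rw [map_sub, Finsupp.sub_apply]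
        rcases hi.eq_or_lt with rfl | hlt
        · rw [hx, sub_self]
        · rw [hm i hlt, h1 n x i hlt, sub_zero]
      have hτ : τ n x ∈ LinearMap.range Ψ := ⟨_, hΨ ⟨n⟩ x⟩
      simpa using Submodule.add_mem _ hmem hτ
  have hs : Function.Surjective Ψ := by
    intro m
    refine hsurj ((φ m).support.sup id + 1) m ?_
    intro i hi
    by_contra hne
    have : i ≤ (φ m).support.sup id := Finset.le_sup (f := id) (by simpa using hne)
    omega
  exact ⟨ULift.{w} ℕ, fun i => I i.down, ⟨(LinearEquiv.ofBijective Ψ ⟨hinj, hs⟩).symm⟩⟩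

end helpers

/-- Pontryagin-type criterion: a countable rank torsion-free module over
an h-local Prüfer domain is isomorphic to a direct sum of ideals iff every finite rank
pure submodule is. -/
theorem stmt7 (hH : IsHLocal R) (hP : IsPruefer R)
    {M : Type v} [AddCommGroup M] [Module R M] [NoZeroSMulDivisors R M]
    (hrank : Module.rank R M ≤ ℵ₀) :
    IsDirectSumOfIdeals R M ↔
      ∀ A : Submodule R M, IsPureSub R A → Module.rank R ↥A < ℵ₀ →
        IsDirectSumOfIdeals R ↥A := by
  have htf : ∀ (r : R) (x : M), r • x = 0 → r = 0 ∨ x = 0 := fun r x h =>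
    NoZeroSMulDivisors.eq_zero_or_eq_zero_of_smul_eq_zero h
  constructor
  · rintro ⟨ι, I, ⟨e⟩⟩ A hA hr
    refine FinSum.isDirectSum (finSum_of_embed hH hP hr I (e.toLinearMap ∘ₗ A.subtype)
      (e.injective.comp Subtype.val_injective) ?_)
    rintro r y hr0 ⟨a, ha⟩
    have ha' : e a = r • y := ha
    have h1 : r • e.symm y = a := by
      apply e.injective
      rw [map_smul, LinearEquiv.apply_symm_apply, ha']
    obtain ⟨z, hz, hz'⟩ := hA 1 1 (fun _ _ => r) (fun _ => a) (fun _ => a.2)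
      ⟨fun _ => e.symm y, fun _ => by simpa using h1⟩
    have h2 : r • z 0 = a := by simpa using hz' 0
    have h3 : z 0 = e.symm y := by
      have h4 : r • (z 0 - e.symm y) = 0 := by rw [smul_sub, h1, h2, sub_self]
      exact sub_eq_zero.1 ((htf _ _ h4).resolve_left hr0)
    exact ⟨⟨z 0, hz 0⟩, by simp [h3]⟩
  · intro hyp
    obtain ⟨φ, hφ⟩ := exists_embed_nat (R := R) M htf hrank
    let A : ℕ → Submodule R M := fun n =>
      { carrier := {x | ∀ i, n ≤ i → φ x i = 0}
        add_mem' := fun {x y} hx hy i hi => by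
          rw [map_add, Finsupp.add_apply, hx i hi, hy i hi, add_zero]
        zero_mem' := fun i _ => by rw [map_zero]; rfl
        smul_mem' := fun c x hx i hi => by
          rw [map_smul, Finsupp.smul_apply, hx i hi, smul_zero] }
    have hA : ∀ n x, x ∈ A n ↔ ∀ i, n ≤ i → φ x i = 0 := fun n x => Iff.rfl
    have hpure : ∀ n, IsPureSub R (A n) := fun n =>
      pure_of_coords hP φ (Set.Ici n) (A n) (fun x => hA n x)
    have hAr : ∀ n, Module.rank R (A n) < ℵ₀ := by
      intro n
      let ρ : A n →ₗ[R] (Fin n → FractionRing R) :=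
        LinearMap.pi (fun i => Finsupp.lapply (R := R) (i : ℕ) ∘ₗ φ ∘ₗ (A n).subtype)
      have hρ : Function.Injective ρ := by
        rw [← LinearMap.ker_eq_bot, LinearMap.ker_eq_bot']
        intro x hx
        apply Subtype.ext
        apply hφ
        ext i
        rw [Submodule.coe_zero, map_zero]
        by_cases hi : i < n
        · exact congrFun hx ⟨i, hi⟩
        · exact (hA n x).1 x.2 i (not_lt.1 hi)
      have h1 := LinearMap.lift_rank_le_of_injective ρ hρ
      have h2 := Module.rank_lt_aleph0 (FractionRing R) (Fin n → FractionRing R)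
      rw [IsLocalization.rank_eq (R := R) (FractionRing R) (nonZeroDivisors R) le_rfl] at h2
      rw [← Cardinal.lift_lt_aleph0]
      exact h1.trans_lt (Cardinal.lift_lt_aleph0.2 h2)
    have hfs : ∀ n, FinSum R (A n) := by
      intro n
      obtain ⟨ι, I, ⟨e⟩⟩ := hyp (A n) (hpure n) (hAr n)
      exact finSum_of_embed hH hP (hAr n) I e.toLinearMap e.injective
        (fun r y _ _ => ⟨e.symm y, by simp⟩)
    let f : ∀ n, A (n + 1) →ₗ[R] FractionRing R := fun n =>
      Finsupp.lapply (R := R) n ∘ₗ φ ∘ₗ (A (n + 1)).subtype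
    have hf : ∀ n x, f n x = φ x n := fun n x => rfl
    have hex : ∀ n, ∃ (I : Ideal R) (τ : I →ₗ[R] M), (∀ x i, n < i → φ (τ x) i = 0) ∧
        (∀ x, φ (τ x) n = 0 → x = 0) ∧
        ∀ m, (∀ i, n < i → φ m i = 0) → ∃ x, φ (τ x) n = φ m n := by
      intro n
      obtain ⟨h1, -, s, hs⟩ := (hfs (n + 1)).splitProp hH hP (f n)
      obtain ⟨I, ⟨e⟩⟩ := h1.equiv
      have hτ : ∀ x, φ (s (e.symm x) : M) n = e.symm x := fun x => hs (e.symm x)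
      refine ⟨I, (A (n + 1)).subtype ∘ₗ s ∘ₗ e.symm.toLinearMap, ?_, ?_, ?_⟩
      · intro x i hi
        exact (hA (n + 1) _).1 (s (e.symm x)).2 i hi
      · intro x hx
        have h2 : (e.symm x : FractionRing R) = 0 := (hτ x).symm.trans hx
        have h3 : e.symm x = 0 := Subtype.ext h2
        simpa using h3
      · intro m hm
        have hm' : m ∈ A (n + 1) := (hA _ _).2 (fun i hi => hm i hi)
        refine ⟨e ⟨f n ⟨m, hm'⟩, ⟨_, rfl⟩⟩, ?_⟩
        refine (hτ _).trans ?_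
        rw [LinearEquiv.symm_apply_apply]
        rfl
    choose I τ h1 h2 h3 using hex
    exact assemble φ hφ I τ h1 h2 h3
end

section
/- Let R be an h-local Prüfer domain and M a torsion-free R-module. Suppose M is the union of a countable ascending chain 0 = M_0 ≤ M_1 ≤ … ≤ M_n ≤ … (n < ω) of submodules such that for every n: (i) M_n is isomorphic to a direct sum of ideals of R, (ii) M_n has countable rank, and (iii) M_n is pure in M. Then M is isomorphic to a direct sum of ideals of R. -/
open DirectSum Cardinal

universe u v w

variable (R : Type u) [CommRing R] [IsDomain R]

section Helpers

variable {R}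

/-- Local comparability over a Prüfer domain, elementwise. -/
theorem pruefer_local (hP : IsPruefer R) (m : Ideal R) [m.IsPrime] (x y : R) :
    ∃ t, t ∉ m ∧ ((∃ c, t * x = c * y) ∨ (∃ c, t * y = c * x)) := by
  classical
  have h1m : (1 : R) ∉ m := fun h => (Ideal.IsPrime.ne_top ‹_›) ((Ideal.eq_top_iff_one _).2 h)
  by_cases hx : x = 0
  · exact ⟨1, h1m, Or.inl ⟨0, by simp [hx]⟩⟩
  let I : Ideal R := Ideal.span {x, y}
  have hxI : x ∈ I := Ideal.subset_span (by simp)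
  have hyI : y ∈ I := Ideal.subset_span (by simp)
  have hfg : I.FG := ⟨{x, y}, by simp [I]⟩
  have := hP I hfg
  let X : I := ⟨x, hxI⟩
  let Y : I := ⟨y, hyI⟩
  let f : (R × R) →ₗ[R] I :=
    (LinearMap.toSpanSingleton R I X).coprod (LinearMap.toSpanSingleton R I Y)
  have hf : Function.Surjective f := by
    rintro ⟨z, hz⟩
    obtain ⟨a, b, hab⟩ := Ideal.mem_span_pair.1 hz
    refine ⟨(a, b), ?_⟩
    apply Subtype.ext
    simp [f, X, Y, hab]
  obtain ⟨g, hg⟩ := Module.projective_lifting_property f LinearMap.id hf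
  have key : ∀ z : I, (z : R) = (g z).1 * x + (g z).2 * y := by
    intro z
    have := congrArg Subtype.val (LinearMap.congr_fun hg z)
    simpa [f, X, Y] using this.symm
  have hsw : x • g Y = y • g X := by
    rw [← map_smul, ← map_smul]
    congr 1
    apply Subtype.ext
    simp [X, Y, mul_comm]
  have h1 : x * (g Y).1 = y * (g X).1 := congrArg Prod.fst hsw
  have h2 : x * (g Y).2 = y * (g X).2 := congrArg Prod.snd hsw
  have hsum : (g X).1 + (g Y).2 = 1 := by
    have := key X
    apply mul_left_cancel₀ hx
    simp only [X] at *
    linear_combination -this + h2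
  by_cases hm : (g X).1 ∈ m
  · refine ⟨(g Y).2, fun h => h1m (hsum ▸ m.add_mem hm h), Or.inl ⟨(g X).2, ?_⟩⟩
    linear_combination h2
  · refine ⟨(g X).1, hm, Or.inr ⟨(g Y).1, ?_⟩⟩
    linear_combination -h1

/-- Containment of `K` in `L` after localizing at `m`. -/
def LocLE (m K L : Ideal R) : Prop := ∀ a ∈ K, ∃ t, t ∉ m ∧ t * a ∈ L

theorem LocLE.trans {m K L N : Ideal R} [hm : m.IsPrime] (h : LocLE m K L) (h' : LocLE m L N) :
    LocLE m K N := by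
  intro a ha
  obtain ⟨t, ht, h1⟩ := h a ha
  obtain ⟨s, hs, h2⟩ := h' _ h1
  refine ⟨s * t, fun h => (hm.mem_or_mem h).elim hs ht, ?_⟩
  rwa [mul_assoc]

theorem locLE_refl (m K : Ideal R) [hm : m.IsPrime] : LocLE m K K := fun a ha =>
  ⟨1, fun h => hm.ne_top ((Ideal.eq_top_iff_one _).2 h), by simpa using ha⟩

theorem locLE_total (hP : IsPruefer R) (m K L : Ideal R) [hm : m.IsPrime] :
    LocLE m K L ∨ LocLE m L K := by
  by_contra! h
  obtain ⟨h1, h2⟩ := h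
  simp only [LocLE, not_forall, not_exists, not_and] at h1 h2
  obtain ⟨a, ha, h1⟩ := h1
  obtain ⟨b, hb, h2⟩ := h2
  obtain ⟨t, ht, ⟨c, hc⟩ | ⟨c, hc⟩⟩ := pruefer_local hP m a b
  · exact h1 t ht (hc ▸ L.mul_mem_left c hb)
  · exact h2 t ht (hc ▸ K.mul_mem_left c ha)

theorem exists_locLE_min (hP : IsPruefer R) (m : Ideal R) [hm : m.IsPrime] {ι : Type*}
    (L : ι → Ideal R) (T : Finset ι) (hT : T.Nonempty) :
    ∃ j ∈ T, ∀ i ∈ T, LocLE m (L j) (L i) := by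
  classical
  induction hT using Finset.Nonempty.cons_induction with
  | singleton a => exact ⟨a, by simp, by simpa using locLE_refl m (L a)⟩
  | cons a s ha hs ih =>
    obtain ⟨j, hj, h⟩ := ih
    rcases locLE_total hP m (L j) (L a) with h' | h'
    · refine ⟨j, by simp [hj], ?_⟩
      intro i hi
      rcases Finset.mem_cons.1 hi with rfl | hi
      · exact h'
      · exact h i hi
    · refine ⟨a, by simp, ?_⟩
      intro i hi
      rcases Finset.mem_cons.1 hi with rfl | hi
      · exact locLE_refl m _
      · exact h'.trans (h i hi)

theorem hlocal_two (hH : IsHLocal R) (m n : Ideal R) (hm : m.IsMaximal) (hn : n.IsMaximal)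
    (hmn : m ≠ n) (d : R) (hd : d ≠ 0) : ∃ a b, a ∉ m ∧ b ∉ n ∧ d ∣ a * b := by
  have := hm.isPrime
  have := hn.isPrime
  by_contra! hcon
  have hdis : Disjoint ((Ideal.span {d} : Ideal R) : Set R)
      ((m.primeCompl ⊔ n.primeCompl : Submonoid R) : Set R) := by
    rw [Set.disjoint_left]
    intro x hx hx'
    obtain ⟨a, ha, b, hb, rfl⟩ := Submonoid.mem_sup.1 hx'
    exact hcon a b ha hb (Ideal.mem_span_singleton.1 hx)
  obtain ⟨p, hp, hle, hpd⟩ := Ideal.exists_le_prime_disjoint _ _ hdis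
  have hp0 : p ≠ ⊥ := by
    rintro rfl
    exact hd (by simpa using hle (Ideal.mem_span_singleton_self d))
  have hle1 : p ≤ m := fun x hx => by
    by_contra h
    exact Set.disjoint_left.1 hpd hx ((le_sup_left : m.primeCompl ≤ _) h)
  have hle2 : p ≤ n := fun x hx => by
    by_contra h
    exact Set.disjoint_left.1 hpd hx ((le_sup_right : n.primeCompl ≤ _) h)
  exact hmn ((hH.1 p hp hp0).unique ⟨hm, hle1⟩ ⟨hn, hle2⟩)

/-- Over an h-local domain, local containment is witnessed uniformly. -/
theorem hlocal_unif (hH : IsHLocal R) (m K L : Ideal R) (hm : m.IsMaximal) (hL : L ≠ ⊥)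
    (h : LocLE m K L) : ∃ s, s ∉ m ∧ ∀ a ∈ K, s * a ∈ L := by
  classical
  have := hm.isPrime
  obtain ⟨d, hdL, hd⟩ := Submodule.exists_mem_ne_zero_of_ne_bot hL
  have hfin := hH.2 d hd
  have hex : ∀ n : Ideal R, ∃ a b, a ∉ m ∧ (n.IsMaximal → n ≠ m → b ∉ n ∧ d ∣ a * b) := by
    intro n
    by_cases hn : n.IsMaximal ∧ n ≠ m
    · obtain ⟨a, b, ha, hb, hab⟩ := hlocal_two hH m n hm hn.1 hn.2.symm d hd
      exact ⟨a, b, ha, fun _ _ => ⟨hb, hab⟩⟩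
    · refine ⟨1, 1, fun h => hm.ne_top ((Ideal.eq_top_iff_one _).2 h), fun h1 h2 => ?_⟩
      exact absurd ⟨h1, h2⟩ hn
  choose a b ha hab using hex
  refine ⟨∏ n ∈ hfin.toFinset, a n, ?_, ?_⟩
  · intro hmem
    obtain ⟨n, -, hn⟩ := (Ideal.IsPrime.prod_mem_iff (hp := hm.isPrime)).1 hmem
    exact ha n hn
  · intro x hx
    set s := ∏ n ∈ hfin.toFinset, a n with hs
    let C : Ideal R := L.colon {s * x}
    have hC : ∀ t, t ∈ C ↔ t * (s * x) ∈ L := fun t => by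
      simp [C, Submodule.mem_colon_singleton]
    suffices C = ⊤ by simpa using (hC 1).1 (this ▸ Submodule.mem_top)
    by_contra hne
    obtain ⟨n, hn, hCn⟩ := Ideal.exists_le_maximal C hne
    by_cases hnm : n = m
    · subst hnm
      obtain ⟨t, ht, htx⟩ := h x hx
      refine ht (hCn ((hC t).2 ?_))
      rw [mul_left_comm]
      exact L.mul_mem_left _ htx
    by_cases hdn : d ∈ n
    · obtain ⟨hb, hdvd⟩ := hab n hn hnm
      refine hb (hCn ((hC _).2 ?_))
      have h1 : d ∣ b n * s := by
        rw [mul_comm]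
        exact hdvd.trans (mul_dvd_mul_right
          (Finset.dvd_prod_of_mem a (hfin.mem_toFinset.2 ⟨hn, hdn⟩)) _)
      obtain ⟨c, hc⟩ := h1
      have : b n * (s * x) = (c * x) * d := by
        rw [← mul_assoc, hc]; ring
      rw [this]
      exact L.mul_mem_left _ hdL
    · refine hdn (hCn ((hC _).2 ?_))
      rw [mul_comm]
      exact L.mul_mem_left _ hdL

/-- The relatively divisible hull of a set. -/
def purif {F : Type*} [AddCommGroup F] [Module R F] (S : Set F) : Submodule R F where
  carrier := {x | ∃ r : R, r ≠ 0 ∧ r • x ∈ Submodule.span R S}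
  zero_mem' := ⟨1, one_ne_zero, by simp⟩
  add_mem' := by
    rintro x y ⟨r, hr, hx⟩ ⟨s, hs, hy⟩
    refine ⟨r * s, mul_ne_zero hr hs, ?_⟩
    rw [smul_add]
    refine Submodule.add_mem _ ?_ ?_
    · rw [mul_comm, mul_smul]; exact Submodule.smul_mem _ _ hx
    · rw [mul_smul]; exact Submodule.smul_mem _ _ hy
  smul_mem' := by
    rintro c x ⟨r, hr, hx⟩
    exact ⟨r, hr, by rw [smul_comm]; exact Submodule.smul_mem _ _ hx⟩

section tf
variable {F : Type*} [AddCommGroup F] [Module R F]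

theorem mem_purif {S : Set F} {x : F} :
    x ∈ purif (R := R) S ↔ ∃ r : R, r ≠ 0 ∧ r • x ∈ Submodule.span R S := Iff.rfl

theorem subset_purif (S : Set F) : S ⊆ purif (R := R) S := fun x hx =>
  ⟨1, one_ne_zero, by simpa using Submodule.subset_span hx⟩

theorem purif_closed {S : Set F} {r : R} {x : F} (hr : r ≠ 0) (h : r • x ∈ purif (R := R) S) :
    x ∈ purif (R := R) S := by
  obtain ⟨s, hs, h⟩ := h
  exact ⟨s * r, mul_ne_zero hs hr, by rwa [mul_smul]⟩

/-- The hull is least among relatively divisible submodules containing the set. -/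
theorem purif_le {S : Set F} {N : Submodule R F} (hN : ∀ (r : R) x, r ≠ 0 → r • x ∈ N → x ∈ N)
    (hS : S ⊆ N) : purif (R := R) S ≤ N := by
  rintro x ⟨r, hr, h⟩
  exact hN r x hr (Submodule.span_le.2 hS h)

theorem purif_mono {S T : Set F} (h : S ⊆ T) : purif (R := R) S ≤ purif T :=
  purif_le (fun _ _ hr h => purif_closed hr h) (h.trans (subset_purif T))

theorem purif_map {G : Type*} [AddCommGroup G] [Module R G] (f : F →ₗ[R] G) {S : Set F} {x : F}
    (h : x ∈ purif (R := R) S) : f x ∈ purif (R := R) (f '' S) := by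
  obtain ⟨r, hr, h⟩ := h
  refine ⟨r, hr, ?_⟩
  rw [← map_smul, Submodule.span_image]
  exact Submodule.mem_map_of_mem h

theorem exists_div [Module.IsTorsionFree R F] (f : F →ₗ[R] F) (c : R) (hc : c ≠ 0)
    (h : ∀ y, ∃ w, c • w = f y) : ∃ g : F →ₗ[R] F, ∀ y, c • g y = f y := by
  choose g hg using h
  have inj : ∀ a b : F, c • a = c • b → a = b := fun a b hab => smul_right_injective F hc hab
  refine ⟨{ toFun := g, map_add' := fun a b => inj _ _ ?_, map_smul' := fun r a => inj _ _ ?_ }, hg⟩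
  · rw [smul_add, hg, hg, hg, map_add]
  · simp only [RingHom.id_apply]
    rw [hg, smul_comm, hg, map_smul]

end tf

section tf2
variable {F : Type*} [AddCommGroup F] [Module R F] [Module.IsTorsionFree R F]

/-- `ρ` is a retraction of `F` onto `P`. -/
def IsRetr (ρ : F →ₗ[R] F) (P : Submodule R F) : Prop :=
  (∀ y, ρ y ∈ P) ∧ ∀ y ∈ P, ρ y = y

/-- The rank one case of Olberding's theorem, locally at a maximal ideal. -/
theorem rank_one_local (hH : IsHLocal R) (hP : IsPruefer R) {ι : Type*} (I : ι → Ideal R)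
    (e : F ≃ₗ[R] ⨁ i, ↥(I i)) (x : F) (hx : x ≠ 0) (m : Ideal R) (hm : m.IsMaximal) :
    ∃ s, s ∉ m ∧ ∃ φ : F →ₗ[R] F, (∀ y, φ y ∈ purif (R := R) {x}) ∧
      ∀ y ∈ purif (R := R) {x}, φ y = s • y := by
  classical
  have hmp := hm.isPrime
  let p : ι → F →ₗ[R] R := fun i => (I i).subtype ∘ₗ DirectSum.component R ι _ i ∘ₗ e.toLinearMap
  have hp : ∀ i y, p i y = ((e y) i : R) := fun i y => rfl
  have hpI : ∀ i y, p i y ∈ I i := fun i y => ((e y) i).2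
  let T : Finset ι := DFinsupp.support (e x)
  have hT : ∀ i, i ∈ T ↔ p i x ≠ 0 := by
    intro i
    simp [T, hp]
  have hTne : T.Nonempty := by
    rw [Finset.nonempty_iff_ne_empty]
    intro h
    apply hx
    apply e.injective
    rw [map_zero]
    exact DFinsupp.support_eq_empty.1 h
  let P : ι → R := fun k => ∏ i ∈ T.erase k, p i x
  let X : R := ∏ i ∈ T, p i x
  have hX : X ≠ 0 := Finset.prod_ne_zero_iff.2 fun i hi => (hT i).1 hi
  have hPX : ∀ k ∈ T, P k * p k x = X := fun k hk => Finset.prod_erase_mul _ _ hk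
  let L : ι → Ideal R := fun k => Ideal.span {P k} * I k
  have hL : ∀ k ∈ T, L k ≠ ⊥ := by
    intro k hk h
    have h1 : P k * p k x ∈ L k := Ideal.mem_span_singleton_mul.2 ⟨_, hpI k x, rfl⟩
    rw [h, hPX k hk] at h1
    exact hX (by simpa using h1)
  obtain ⟨j, hj, hmin⟩ := exists_locLE_min hP m L T hTne
  have hex : ∀ i, ∃ s, s ∉ m ∧ (i ∈ T → ∀ y ∈ I j, ∃ z ∈ I i, p j x * z = s * y * p i x) := by
    intro i
    by_cases hi : i ∈ T
    · obtain ⟨s, hs, h⟩ := hlocal_unif hH m (L j) (L i) hm (hL i hi) (hmin i hi)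
      refine ⟨s, hs, fun _ y hy => ?_⟩
      obtain ⟨z, hz, hzz⟩ := Ideal.mem_span_singleton_mul.1
        (h (P j * y) (Ideal.mem_span_singleton_mul.2 ⟨y, hy, rfl⟩))
      refine ⟨z, hz, mul_left_cancel₀ hX ?_⟩
      have h1 := hPX i hi
      have h2 := hPX j hj
      linear_combination (p i x * p j x) * hzz - (p j x * z) * h1 + (s * y * p i x) * h2
    · exact ⟨1, fun h => hm.ne_top ((Ideal.eq_top_iff_one _).2 h), fun h => absurd h hi⟩
  choose s hs hsz using hex
  let S := ∏ i ∈ T, s i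
  have hSz : ∀ i, ∀ y ∈ I j, ∃ z ∈ I i, p j x * z = S * y * p i x := by
    intro i y hy
    by_cases hi : i ∈ T
    · obtain ⟨z, hz, h⟩ := hsz i hi y hy
      obtain ⟨c, hc⟩ : s i ∣ S := Finset.dvd_prod_of_mem s hi
      refine ⟨c * z, (I i).mul_mem_left _ hz, ?_⟩
      rw [hc]
      linear_combination c * h
    · refine ⟨0, (I i).zero_mem, ?_⟩
      have : p i x = 0 := by
        by_contra h
        exact hi ((hT i).2 h)
      rw [this]; simp
  have hxj : p j x ≠ 0 := (hT j).1 hj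
  have hdiv : ∀ y : F, ∃ w : F, p j x • w = (S * p j y) • x := by
    intro y
    choose z hz hzz using fun i => hSz i (p j y) (hpI j y)
    refine ⟨e.symm (DirectSum.mk (fun i => I i) T fun i => ⟨z i, hz i⟩), ?_⟩
    apply e.injective
    rw [map_smul, map_smul, e.apply_symm_apply]
    apply DFinsupp.ext
    intro i
    apply Subtype.ext
    by_cases hi : i ∈ T
    · have h1 : (DirectSum.mk (fun i => I i) T fun i => ⟨z i, hz i⟩) i = ⟨z i, hz i⟩ :=
        DirectSum.mk_apply_of_mem hi
      rw [DirectSum.smul_apply, DirectSum.smul_apply, h1]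
      exact hzz i
    · have h1 : (DirectSum.mk (fun i => I i) T fun i => ⟨z i, hz i⟩) i = 0 :=
        DirectSum.mk_apply_of_notMem hi
      rw [DirectSum.smul_apply, DirectSum.smul_apply, h1]
      have h2 : e x i = 0 := by
        apply Subtype.ext
        by_contra h
        exact hi ((hT i).2 h)
      rw [h2]; simp
  obtain ⟨φ, hφ⟩ := exists_div ((LinearMap.toSpanSingleton R F x) ∘ₗ (S • p j)) (p j x) hxj
    (fun y => by simpa using hdiv y)
  have hφ' : ∀ y, p j x • φ y = (S * p j y) • x := fun y => by simpa using hφ y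
  refine ⟨S, ?_, φ, ?_, ?_⟩
  · intro hmem
    obtain ⟨n, -, hn⟩ := (Ideal.IsPrime.prod_mem_iff (hp := hm.isPrime)).1 hmem
    exact hs n hn
  · intro y
    exact ⟨p j x, hxj, by rw [hφ']; exact Submodule.smul_mem _ _ (Submodule.mem_span_singleton_self x)⟩
  · rintro y ⟨r, hr, hy⟩
    obtain ⟨c, hc⟩ := Submodule.mem_span_singleton.1 hy
    have h1 : c * p j x = r * p j y := by
      have := congrArg (p j) hc
      simpa using this
    apply smul_right_injective F (mul_ne_zero hr hxj)
    change (r * p j x) • φ y = (r * p j x) • S • y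
    rw [mul_smul, hφ', smul_smul, smul_comm (r * p j x) S y, mul_comm r (p j x), mul_smul (p j x) r y,
      ← hc, smul_smul, smul_smul]
    congr 1
    linear_combination -S * h1

theorem rank_one (hH : IsHLocal R) (hP : IsPruefer R) {ι : Type*} (I : ι → Ideal R)
    (e : F ≃ₗ[R] ⨁ i, ↥(I i)) (x : F) : ∃ φ : F →ₗ[R] F, IsRetr φ (purif (R := R) {x}) := by
  by_cases hx : x = 0
  · refine ⟨0, fun y => Submodule.zero_mem _, ?_⟩
    rintro y ⟨r, hr, hy⟩
    subst hx
    simpa [hr, eq_comm] using hy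
  let A : Ideal R :=
    { carrier := {s | ∃ φ : F →ₗ[R] F, (∀ y, φ y ∈ purif (R := R) {x}) ∧
        ∀ y ∈ purif (R := R) {x}, φ y = s • y}
      zero_mem' := ⟨0, fun y => Submodule.zero_mem _, fun y _ => by simp⟩
      add_mem' := by
        rintro a b ⟨f, hf, hf'⟩ ⟨g, hg, hg'⟩
        refine ⟨f + g, fun y => Submodule.add_mem _ (hf y) (hg y), fun y hy => ?_⟩
        rw [LinearMap.add_apply, hf' y hy, hg' y hy, add_smul]
      smul_mem' := by
        rintro c a ⟨f, hf, hf'⟩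
        refine ⟨c • f, fun y => Submodule.smul_mem _ _ (hf y), fun y hy => ?_⟩
        rw [LinearMap.smul_apply, hf' y hy, smul_smul, smul_eq_mul] }
  have hA : A = ⊤ := by
    by_contra hne
    obtain ⟨m, hm, hAm⟩ := Ideal.exists_le_maximal A hne
    obtain ⟨s, hs, h⟩ := rank_one_local hH hP I e x hx m hm
    exact hs (hAm h)
  obtain ⟨φ, h1, h2⟩ : (1 : R) ∈ A := hA ▸ Submodule.mem_top
  exact ⟨φ, h1, fun y hy => by simpa using h2 y hy⟩

/-- Finite rank relatively divisible submodules are summands. -/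
theorem finite_rank (hH : IsHLocal R) (hP : IsPruefer R) {ι : Type*} (I : ι → Ideal R)
    (e : F ≃ₗ[R] ⨁ i, ↥(I i)) (n : ℕ) : ∀ v : Fin n → F,
    ∃ φ : F →ₗ[R] F, IsRetr φ (purif (R := R) (Set.range v)) := by
  induction n with
  | zero =>
    intro v
    refine ⟨0, fun y => Submodule.zero_mem _, ?_⟩
    rintro y ⟨r, hr, hy⟩
    rw [Set.range_eq_empty] at hy
    simpa [hr, eq_comm] using hy
  | succ n ih =>
    intro v
    obtain ⟨π, hπ, hπ'⟩ := rank_one hH hP I e (v 0)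
    let σ : F →ₗ[R] F := LinearMap.id - π
    obtain ⟨ρ, hρ, hρ'⟩ := ih (fun i => σ (v i.succ))
    have hle : purif (R := R) {v 0} ≤ purif (R := R) (Set.range v) :=
      purif_mono (by rintro _ rfl; exact ⟨0, rfl⟩)
    have hle2 : purif (R := R) (Set.range fun i : Fin n => σ (v i.succ)) ≤
        purif (R := R) (Set.range v) := by
      apply purif_le (fun _ _ hr h => purif_closed hr h)
      rintro _ ⟨i, rfl⟩
      exact Submodule.sub_mem _ (subset_purif _ ⟨i.succ, rfl⟩) (hle (hπ _))
    refine ⟨π + ρ ∘ₗ σ, fun y => ?_, fun y hy => ?_⟩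
    · exact Submodule.add_mem _ (hle (hπ y)) (hle2 (hρ _))
    · have h1 : σ y ∈
          purif (R := R) (Set.range fun i : Fin n => σ (v i.succ)) := by
        refine purif_le (fun _ _ hr h => purif_closed hr h) ?_ (purif_map σ hy)
        rintro _ ⟨_, ⟨i, rfl⟩, rfl⟩
        refine Fin.cases ?_ (fun i => ?_) i
        · have : σ (v 0) = 0 := by
            simp [σ, hπ' (v 0) (subset_purif _ rfl)]
          rw [this]
          exact Submodule.zero_mem _
        · exact subset_purif _ ⟨i, rfl⟩
      rw [LinearMap.add_apply, LinearMap.comp_apply, hρ' _ h1]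
      simp [σ]

end tf2

section step
variable {F : Type*} [AddCommGroup F] [Module R F] [Module.IsTorsionFree R F]

theorem coord_inj {ι : Type*} (I : ι → Ideal R) (e : F ≃ₗ[R] ⨁ i, ↥(I i)) (g : F) :
    ∃ f : F →ₗ[R] R, ∀ c ∈ purif (R := R) {g}, f c = 0 → c = 0 := by
  classical
  by_cases hg : g = 0
  · refine ⟨0, ?_⟩
    rintro c ⟨r, hr, hc⟩ -
    subst hg
    simpa [hr] using hc
  · have : ∃ i, e g i ≠ 0 := by
      by_contra! h
      apply hg
      apply e.injective
      rw [map_zero]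
      exact DFinsupp.ext h
    obtain ⟨i, hi⟩ := this
    let p : F →ₗ[R] R := (I i).subtype ∘ₗ DirectSum.component R ι _ i ∘ₗ e.toLinearMap
    have hp : p g ≠ 0 := fun h => hi (Subtype.ext h)
    refine ⟨p, ?_⟩
    rintro c ⟨r, hr, hc⟩ h0
    obtain ⟨a, ha⟩ := Submodule.mem_span_singleton.1 hc
    have h1 : a * p g = r * p c := by simpa using congrArg p ha
    rw [h0, mul_zero] at h1
    have h2 : a = 0 := (mul_eq_zero.1 h1).resolve_right hp
    rw [h2, zero_smul] at ha
    exact (smul_eq_zero.1 ha.symm).resolve_left hr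

theorem step_in (hH : IsHLocal R) (hP : IsPruefer R) {ι : Type*} (I : ι → Ideal R)
    (e : F ≃ₗ[R] ⨁ i, ↥(I i)) (k : ℕ) (v : Fin (k + 1) → F) :
    ∃ C : Submodule R F, C ≤ purif (R := R) (Set.range v) ∧
      purif (R := R) (Set.range v) ≤ purif (R := R) (Set.range fun i : Fin k => v i.castSucc) ⊔ C ∧
      Disjoint (purif (R := R) (Set.range fun i : Fin k => v i.castSucc)) C ∧
      ∃ f : C →ₗ[R] R, Function.Injective f := by
  obtain ⟨φ, hφ, hφ'⟩ := finite_rank hH hP I e k (fun i => v i.castSucc)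
  have hle : purif (R := R) (Set.range fun i : Fin k => v i.castSucc) ≤
      purif (R := R) (Set.range v) :=
    purif_mono (by rintro _ ⟨i, rfl⟩; exact ⟨i.castSucc, rfl⟩)
  let σ : F →ₗ[R] F := LinearMap.id - φ
  have hσ : ∀ y, σ y = y - φ y := fun y => rfl
  obtain ⟨f, hf⟩ := coord_inj I e (σ (v (Fin.last k)))
  refine ⟨LinearMap.ker φ ⊓ purif (R := R) (Set.range v), inf_le_right, ?_, ?_, f ∘ₗ Submodule.subtype _, ?_⟩
  · intro y hy
    have : y = φ y + σ y := by rw [hσ]; abel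
    rw [this]
    refine Submodule.add_mem_sup (hφ y) ⟨?_, ?_⟩
    · rw [SetLike.mem_coe, LinearMap.mem_ker, hσ, map_sub, hφ' _ (hφ y), sub_self]
    · exact Submodule.sub_mem _ hy (hle (hφ y))
  · rw [Submodule.disjoint_def]
    intro y hy hy'
    rw [← hφ' y hy]
    exact hy'.1
  · rw [← LinearMap.ker_eq_bot, LinearMap.ker_eq_bot']
    rintro ⟨c, hc1, hc2⟩ h
    apply Subtype.ext
    refine hf c ?_ h
    have h1 : σ c = c := by rw [hσ, LinearMap.mem_ker.1 hc1, sub_zero]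
    rw [← h1]
    refine purif_le (fun _ _ hr h => purif_closed hr h) ?_ (purif_map σ hc2)
    rintro _ ⟨_, ⟨i, rfl⟩, rfl⟩
    refine Fin.lastCases ?_ (fun i => ?_) i
    · exact subset_purif _ rfl
    · have : σ (v i.castSucc) = 0 := by
        rw [hσ, hφ' _ (subset_purif _ ⟨i, rfl⟩), sub_self]
      rw [this]
      exact Submodule.zero_mem _

theorem map_purif (N : Submodule R F) (hN : ∀ (r : R) x, r ≠ 0 → r • x ∈ N → x ∈ N) (S : Set N) :
    (purif (R := R) S).map N.subtype = purif (R := R) (N.subtype '' S) := by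
  apply le_antisymm
  · rintro _ ⟨y, hy, rfl⟩
    exact purif_map _ hy
  · intro y hy
    have hyN : y ∈ N := by
      refine purif_le hN ?_ hy
      rintro _ ⟨z, -, rfl⟩
      exact z.2
    refine ⟨⟨y, hyN⟩, ?_, rfl⟩
    obtain ⟨r, hr, h⟩ := hy
    refine ⟨r, hr, ?_⟩
    rw [Submodule.span_image] at h
    obtain ⟨z, hz, hzy⟩ := h
    have : z = r • (⟨y, hyN⟩ : N) := Subtype.ext hzy
    rwa [← this]

theorem step_sub (hH : IsHLocal R) (hP : IsPruefer R) (N : Submodule R F)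
    (hN : ∀ (r : R) x, r ≠ 0 → r • x ∈ N → x ∈ N) {ι : Type*} (I : ι → Ideal R)
    (e : N ≃ₗ[R] ⨁ i, ↥(I i)) (b : ℕ → F) (k : ℕ) (hb : ∀ i < k + 1, b i ∈ N) :
    ∃ C : Submodule R F, C ≤ purif (R := R) (Set.range fun i : Fin (k + 1) => b i) ∧
      purif (R := R) (Set.range fun i : Fin (k + 1) => b i) ≤
        purif (R := R) (Set.range fun i : Fin k => b i) ⊔ C ∧
      Disjoint (purif (R := R) (Set.range fun i : Fin k => b i)) C ∧
      ∃ f : C →ₗ[R] R, Function.Injective f := by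
  obtain ⟨C, h1, h2, h3, f, hf⟩ := step_in hH hP I e k (fun i => ⟨b i, hb i i.2⟩)
  have e1 : purif (R := R) (Set.range fun i : Fin (k + 1) => b i) =
      (purif (R := R) (Set.range fun i : Fin (k + 1) => (⟨b i, hb i i.2⟩ : N))).map N.subtype := by
    rw [map_purif N hN, ← Set.range_comp]; rfl
  have e2 : purif (R := R) (Set.range fun i : Fin k => b i) =
      (purif (R := R) (Set.range fun i : Fin k =>
        (⟨b i.castSucc, hb _ i.castSucc.2⟩ : N))).map N.subtype := by
    rw [map_purif N hN, ← Set.range_comp]; rfl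
  have hinj : Function.Injective N.subtype := N.injective_subtype
  refine ⟨C.map N.subtype, ?_, ?_, ?_, f ∘ₗ (Submodule.equivMapOfInjective N.subtype hinj C).symm.toLinearMap, ?_⟩
  · rw [e1]; exact Submodule.map_mono h1
  · rw [e1, e2, ← Submodule.map_sup]; exact Submodule.map_mono h2
  · rw [e2]
    exact Submodule.disjoint_map hinj h3
  · exact hf.comp (LinearEquiv.injective _)

theorem chain_injective (A : ℕ → Submodule R F) (hA : Monotone A) (C : ℕ → Submodule R F)
    (h1 : ∀ k, C k ≤ A (k + 1)) (h3 : ∀ k, Disjoint (A k) (C k)) :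
    Function.Injective (DirectSum.coeLinearMap C) := by
  classical
  rw [← LinearMap.ker_eq_bot, LinearMap.ker_eq_bot']
  intro g hg
  by_contra hne
  have hT : (DFinsupp.support g).Nonempty := by
    rw [Finset.nonempty_iff_ne_empty]
    intro h
    exact hne (DFinsupp.support_eq_empty.1 h)
  let K := (DFinsupp.support g).max' hT
  have hK : K ∈ DFinsupp.support g := Finset.max'_mem _ _
  have hsum : ∑ i ∈ DFinsupp.support g, (g i : F) = 0 := by
    rw [DirectSum.coeLinearMap_eq_dfinsuppSum] at hg
    exact hg
  rw [← Finset.add_sum_erase _ _ hK] at hsum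
  have hmem : (g K : F) ∈ A K := by
    rw [eq_neg_of_add_eq_zero_left hsum]
    refine Submodule.neg_mem _ (Submodule.sum_mem _ fun i hi => ?_)
    have hlt : i < K := lt_of_le_of_ne (Finset.le_max' _ _ (Finset.mem_of_mem_erase hi))
      (Finset.ne_of_mem_erase hi)
    exact hA hlt (h1 i (g i).2)
  have h0 : (g K : F) = 0 := Submodule.disjoint_def.1 (h3 K) _ hmem (g K).2
  exact (DFinsupp.mem_support_iff.1 hK) (Subtype.ext h0)

end step

end Helpers

/-- Pontryagin-type theorem: a torsion-free module over an h-local Prüfer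
domain which is the union of a countable ascending chain of countable rank pure
submodules isomorphic to direct sums of ideals is isomorphic to a direct sum of ideals. -/
theorem stmt8 (hH : IsHLocal R) (hP : IsPruefer R)
    {M : Type v} [AddCommGroup M] [Module R M] [NoZeroSMulDivisors R M]
    (Mn : ℕ → Submodule R M) (hmono : Monotone Mn)
    (h0 : Mn 0 = ⊥) (hunion : ⨆ n, Mn n = ⊤)
    (hds : ∀ n, IsDirectSumOfIdeals R ↥(Mn n))
    (hrank : ∀ n, Module.rank R ↥(Mn n) ≤ ℵ₀)
    (hpure : ∀ n, IsPureSub R (Mn n)) :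
    IsDirectSumOfIdeals R M := by
  classical
  choose ι I hI using hds
  have eqv := fun n => (hI n).some
  have hclosed : ∀ n (r : R) (x : M), r ≠ 0 → r • x ∈ Mn n → x ∈ Mn n := by
    intro n r x hr hx
    obtain ⟨y, hy, h⟩ := hpure n 1 1 (fun _ _ => r) (fun _ => r • x) (fun _ => hx)
      ⟨fun _ => x, by simp⟩
    have h1 : r • y 0 = r • x := by simpa using h 0
    have h2 : y 0 = x := smul_right_injective M hr h1
    exact h2 ▸ hy 0
  have hmem : ∀ x : M, ∃ n, x ∈ Mn n := by
    intro x
    have : x ∈ ⨆ n, Mn n := hunion ▸ Submodule.mem_top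
    exact (Submodule.mem_iSup_of_directed _ hmono.directed_le).1 this
  have hs : ∀ n, ∃ s : Set (Mn n), s.Countable ∧ ∀ x : Mn n, x ∈ purif (R := R) s := by
    intro n
    obtain ⟨s, hs, h⟩ := exists_maximal_linearIndepOn R (id : Mn n → Mn n)
    refine ⟨s, ?_, fun x => ?_⟩
    · rw [← Cardinal.le_aleph0_iff_set_countable]
      exact (LinearIndependent.cardinal_le_rank hs).trans (hrank n)
    · by_cases hx : x ∈ s
      · exact subset_purif s hx
      · obtain ⟨a, ha, h'⟩ := h x hx
        exact ⟨a, ha, by simpa using h'⟩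
  choose s hsc hsp using hs
  obtain ⟨b, hb⟩ := Set.Countable.exists_eq_range
    (s := insert (0 : M) (⋃ n, ((Mn n).subtype '' s n)))
    ((Set.countable_iUnion fun n => (hsc n).image _).insert 0) (Set.insert_nonempty _ _)
  have hbtop : ∀ x : M, x ∈ purif (R := R) (Set.range b) := by
    intro x
    obtain ⟨n, hn⟩ := hmem x
    have h1 := purif_map (Mn n).subtype (hsp n ⟨x, hn⟩)
    refine purif_mono ?_ h1
    rw [← hb]
    exact (Set.subset_iUnion (fun n => ((Mn n).subtype '' s n)) n).trans (Set.subset_insert _ _)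
  have hbn : ∀ k, ∃ n, ∀ i < k, b i ∈ Mn n := by
    intro k
    choose N hN using hmem
    refine ⟨(Finset.range k).sup fun i => N (b i), fun i hi => ?_⟩
    exact hmono (Finset.le_sup (f := fun i => N (b i)) (Finset.mem_range.2 hi)) (hN (b i))
  let A : ℕ → Submodule R M := fun k => purif (R := R) (Set.range fun i : Fin k => b i)
  have hC : ∀ k, ∃ C : Submodule R M, C ≤ A (k + 1) ∧ A (k + 1) ≤ A k ⊔ C ∧ Disjoint (A k) C ∧
      ∃ f : C →ₗ[R] R, Function.Injective f := by
    intro k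
    obtain ⟨n, hn⟩ := hbn (k + 1)
    exact step_sub hH hP (Mn n) (hclosed n) (I n) (eqv n) b k hn
  choose C hC1 hC2 hC3 f hf using hC
  have hA0 : A 0 = ⊥ := by
    rw [eq_bot_iff]
    rintro y ⟨r, hr, hy⟩
    rw [Set.range_eq_empty] at hy
    simpa [hr] using hy
  have hAmono : Monotone A := by
    intro k l hkl
    apply purif_mono
    rintro _ ⟨i, rfl⟩
    exact ⟨Fin.castLE hkl i, rfl⟩
  have hAle : ∀ k, A k ≤ ⨆ i, C i := by
    intro k
    induction k with
    | zero => rw [hA0]; exact bot_le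
    | succ k ih => exact (hC2 k).trans (sup_le ih (le_iSup C k))
  have htop : ⨆ i, C i = ⊤ := by
    rw [eq_top_iff]
    intro x _
    obtain ⟨r, hr, hx⟩ := hbtop x
    have h1 : Submodule.span R (Set.range b) ≤ ⨆ k, A k := by
      rw [Submodule.span_le]
      rintro _ ⟨i, rfl⟩
      exact Submodule.mem_iSup_of_mem (i + 1) (subset_purif _ ⟨Fin.last i, rfl⟩)
    obtain ⟨k, hk⟩ := (Submodule.mem_iSup_of_directed _ hAmono.directed_le).1 (h1 hx)
    exact hAle k (purif_closed hr hk)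
  have hint : DirectSum.IsInternal C := by
    refine ⟨chain_injective A hAmono C hC1 hC3, ?_⟩
    have := (Submodule.iSup_eq_range_dfinsupp_lsum C).symm.trans htop
    exact LinearMap.range_eq_top.1 this
  let E1 : (⨁ k, C k) ≃ₗ[R] M := LinearEquiv.ofBijective (DirectSum.coeLinearMap C) hint
  let E2 : (⨁ k, C k) ≃ₗ[R] ⨁ k, LinearMap.range (f k) :=
    DFinsupp.mapRange.linearEquiv fun k => LinearEquiv.ofInjective (f k) (hf k)
  exact ⟨ULift ℕ, fun k => LinearMap.range (f k.down),
    ⟨E1.symm ≪≫ₗ E2 ≪≫ₗ DirectSum.lequivCongrLeft R Equiv.ulift.symm⟩⟩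
end

section
/- Let R be a Dedekind domain with a countable number of maximal ideals and M a torsion-free R-module. If M is the union of a countable ascending chain 0 = M_0 ≤ M_1 ≤ … of pure submodules each of which is projective, then M is projective. -/
open DirectSum Cardinal

universe u v w

variable (R : Type u) [CommRing R] [IsDomain R]

section helpers

set_option linter.overlappingInstances false

variable {R}

/-- Zorn-style devissage: extend a section through a chain-closed family. -/
theorem aux_devissage {N : Type v} [AddCommGroup N] [Module R N]
    (S : Set (Submodule R N)) (hbot : ⊥ ∈ S)
    (hchain : ∀ c ⊆ S, c.Nonempty → IsChain (· ≤ ·) c → sSup c ∈ S)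
    (hstep : ∀ A ∈ S, A ≠ ⊤ → ∃ A' ∈ S, A < A' ∧ Module.Projective R (A'.map A.mkQ)) :
    Module.Projective R N := by
  classical
  let π : (N →₀ R) →ₗ[R] N := Finsupp.linearCombination R id
  have hπ : Function.Surjective π := Finsupp.linearCombination_id_surjective R N
  let P : Set (N →ₗ.[R] (N →₀ R)) := {f | f.domain ∈ S ∧ ∀ x : f.domain, π (f x) = x}
  have hbotP : (⊥ : N →ₗ.[R] (N →₀ R)) ∈ P := by
    refine ⟨hbot, ?_⟩
    rintro ⟨x, hx⟩
    have hx0 : x = 0 := (Submodule.mem_bot R).1 hx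
    subst hx0
    have : (⟨0, hx⟩ : (⊥ : N →ₗ.[R] (N →₀ R)).domain) = 0 := rfl
    rw [this, LinearPMap.map_zero, map_zero]
    rfl
  obtain ⟨f, -, hf⟩ := zorn_le_nonempty₀ P (by
    intro c hc hch y hy
    have hd : DirectedOn (· ≤ ·) c := hch.directedOn
    refine ⟨LinearPMap.sSup c hd, ⟨?_, ?_⟩, fun z hz => LinearPMap.le_sSup hd hz⟩
    · rw [LinearPMap.domain_sSup]
      refine hchain _ ?_ (Set.Nonempty.image _ ⟨y, hy⟩) ?_
      · rintro _ ⟨g, hg, rfl⟩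
        exact (hc hg).1
      · rintro _ ⟨a, ha, rfl⟩ _ ⟨b, hb, rfl⟩ _
        exact (hch.total ha hb).imp (fun h => h.1) (fun h => h.1)
    · rintro ⟨x, hx⟩
      obtain ⟨g, hg, hxg⟩ := (LinearPMap.mem_domain_sSup_iff ⟨y, hy⟩ hd).1 hx
      have := LinearPMap.sSup_apply hd hg ⟨x, hxg⟩
      erw [this]
      exact (hc hg).2 ⟨x, hxg⟩) ⊥ hbotP
  obtain ⟨⟨hfS, hfπ⟩, hmax⟩ := hf
  by_cases htop : f.domain = ⊤
  · let σ : N →ₗ[R] (N →₀ R) := f.toFun ∘ₗ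
      (LinearMap.codRestrict f.domain LinearMap.id (fun x => by rw [htop]; trivial))
    exact Module.Projective.of_split σ π (LinearMap.ext fun x => hfπ ⟨x, by rw [htop]; trivial⟩)
  · exfalso
    obtain ⟨A', hA'S, hlt, hproj⟩ := hstep _ hfS htop
    set A := f.domain with hA
    obtain ⟨τ, hτ⟩ := Module.projective_lifting_property (A.mkQ ∘ₗ π) (A'.map A.mkQ).subtype
      ((Submodule.mkQ_surjective A).comp hπ)
    have hτ' : ∀ d, A.mkQ (π (τ d)) = d := fun d => LinearMap.congr_fun hτ d
    let q : A' →ₗ[R] (A'.map A.mkQ) :=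
      LinearMap.codRestrict _ (A.mkQ ∘ₗ A'.subtype) (fun x => ⟨x, x.2, rfl⟩)
    let d : A' →ₗ[R] A := LinearMap.codRestrict A (A'.subtype - π ∘ₗ τ ∘ₗ q) (by
      intro x
      rw [← Submodule.Quotient.mk_eq_zero, ← Submodule.mkQ_apply]
      simp only [LinearMap.sub_apply, map_sub, LinearMap.comp_apply]
      rw [hτ']
      exact sub_self _)
    let g : N →ₗ.[R] (N →₀ R) := ⟨A', f.toFun ∘ₗ d + τ ∘ₗ q⟩
    have hg : g ∈ P := by
      refine ⟨hA'S, fun x => ?_⟩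
      change π (f (d x) + τ (q x)) = x
      rw [map_add, hfπ]
      change (x : N) - π (τ (q x)) + π (τ (q x)) = x
      abel
    have hfg : f ≤ g := by
      refine ⟨hlt.le, ?_⟩
      intro x y hxy
      change f x = f (d y) + τ (q y)
      have hq : q y = 0 := by
        apply Subtype.ext
        change A.mkQ (y : N) = 0
        rw [← hxy]
        simp
      have hd : d y = x := by
        apply Subtype.ext
        change (y : N) - π (τ (q y)) = x
        rw [hq, hxy]; simp
      rw [hq, hd]; simp
    exact hlt.not_ge (hmax hg hfg).1

/-- `N` is relatively divisible (torsion-free quotient). -/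
def AuxTF {N : Type v} [AddCommGroup N] [Module R N] (A : Submodule R N) : Prop :=
  ∀ r : R, r ≠ 0 → ∀ x : N, r • x ∈ A → x ∈ A

theorem aux_tf_quot {N : Type v} [AddCommGroup N] [Module R N] {A : Submodule R N}
    (h : AuxTF A) : Module.IsTorsionFree R (N ⧸ A) := by
  refine .of_smul_eq_zero ?_
  intro r x hx
  obtain ⟨x, rfl⟩ := Submodule.Quotient.mk_surjective A x
  by_cases hr : r = 0
  · exact Or.inl hr
  · right
    rw [← Submodule.Quotient.mk_smul, Submodule.Quotient.mk_eq_zero] at hx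
    rw [Submodule.Quotient.mk_eq_zero]
    exact h r hr x hx

/-- The pure closure. -/
def auxCl {N : Type v} [AddCommGroup N] [Module R N] (A : Submodule R N) : Submodule R N where
  carrier := {x | ∃ r : R, r ≠ 0 ∧ r • x ∈ A}
  zero_mem' := ⟨1, one_ne_zero, by simp⟩
  add_mem' := by
    rintro x y ⟨r, hr, hx⟩ ⟨s, hs, hy⟩
    refine ⟨r * s, mul_ne_zero hr hs, ?_⟩
    rw [smul_add, mul_smul, mul_comm, mul_smul, smul_comm s r y, smul_comm r s y, smul_comm r s x] 
    refine A.add_mem ?_ ?_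
    · exact A.smul_mem _ hx
    · rw [smul_comm]; exact A.smul_mem _ hy
  smul_mem' := by
    rintro c x ⟨r, hr, hx⟩
    exact ⟨r, hr, by rw [smul_comm]; exact A.smul_mem _ hx⟩

theorem aux_le_cl {N : Type v} [AddCommGroup N] [Module R N] (A : Submodule R N) : A ≤ auxCl A :=
  fun x hx => ⟨1, one_ne_zero, by simpa using hx⟩

theorem aux_cl_mono {N : Type v} [AddCommGroup N] [Module R N] {A B : Submodule R N}
    (h : A ≤ B) : auxCl A ≤ auxCl B :=
  fun _ ⟨r, hr, hx⟩ => ⟨r, hr, h hx⟩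

theorem aux_cl_tf {N : Type v} [AddCommGroup N] [Module R N] (A : Submodule R N) :
    AuxTF (auxCl A) := by
  rintro r hr x ⟨s, hs, hx⟩
  exact ⟨s * r, mul_ne_zero hs hr, by rwa [mul_smul]⟩

/-- Pontryagin's criterion for countably generated modules. -/
theorem aux_pontryagin [IsDedekindDomain R] {N : Type v} [AddCommGroup N] [Module R N]
    [Module.IsTorsionFree R N]
    (hfg : ∀ T : Finset N, (auxCl (Submodule.span R (T : Set N))).FG)
    (d : ℕ → N) (hd : Submodule.span R (Set.range d) = ⊤) : Module.Projective R N := by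
  classical
  let D : ℕ → Submodule R N := fun k => auxCl (Submodule.span R (d '' Set.Iio k))
  have hDmono : Monotone D := fun a b h =>
    aux_cl_mono (Submodule.span_mono (Set.image_mono (Set.Iio_subset_Iio h)))
  have hDfg : ∀ k, (D k).FG := by
    intro k
    have := hfg ((Finset.range k).image d)
    simpa [D] using this
  have hD0 : D 0 = ⊥ := by
    rw [eq_bot_iff]
    rintro x ⟨r, hr, hx⟩
    simp at hx
    simpa [hr] using hx
  have hmemD : ∀ k, d k ∈ D (k + 1) := fun k =>
    aux_le_cl _ (Submodule.subset_span ⟨k, by simp, rfl⟩)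
  have htop : ∀ A : Submodule R N, (∀ k, D k ≤ A) → A = ⊤ := by
    intro A hA
    rw [eq_top_iff, ← hd, Submodule.span_le]
    rintro _ ⟨k, rfl⟩
    exact hA _ (hmemD k)
  refine aux_devissage (Set.range D ∪ {⊤}) (Or.inl ⟨0, hD0⟩) ?_ ?_
  · intro c hc hne hch
    by_cases hb : ∃ k, ∀ A ∈ c, A ≤ D k ∧ A ≠ ⊤
    · obtain ⟨k, hk⟩ := hb
      -- all members are among `D 0, ..., D k`
      have hfin : c.Finite := by
        refine ((Set.finite_Iic k).image D).subset ?_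
        intro A hA
        rcases hc hA with ⟨j, rfl⟩ | h
        · rcases le_total j k with hjk | hjk
          · exact ⟨j, hjk, rfl⟩
          · exact ⟨k, le_refl k, le_antisymm (hDmono hjk) (hk _ hA).1⟩
        · exact absurd h (hk _ hA).2
      obtain ⟨m, hm⟩ := hfin.exists_maximal hne
      have : sSup c = m := by
        refine le_antisymm (sSup_le fun A hA => ?_) (le_sSup hm.1)
        rcases hch.total hA hm.1 with h | h
        · exact h
        · exact hm.2 hA h
      rw [this]; exact hc hm.1
    · push Not at hb
      right
      refine htop _ fun k => ?_
      obtain ⟨A, hA, h⟩ := hb k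
      refine le_trans ?_ (le_sSup hA)
      by_cases hAk : A ≤ D k
      · rw [h hAk]; exact le_top
      · rcases hc hA with ⟨j, rfl⟩ | h'
        · rcases le_total j k with hjk | hjk
          · exact absurd (hDmono hjk) hAk
          · exact hDmono hjk
        · rw [Set.mem_singleton_iff.1 h']; exact le_top
  · rintro A (⟨k, rfl⟩ | h) hAtop
    swap
    · exact absurd h hAtop
    have : ∃ j, k ≤ j ∧ ¬ D j ≤ D k := by
      by_contra hcon
      push Not at hcon
      exact hAtop (htop _ fun j => (hDmono (le_max_left j k)).trans (hcon _ (le_max_right j k)))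
    obtain ⟨j, hkj, hj⟩ := this
    refine ⟨D j, Or.inl ⟨j, rfl⟩, lt_of_le_not_ge (hDmono hkj) hj, ?_⟩
    have := aux_tf_quot (aux_cl_tf (Submodule.span R (d '' Set.Iio k)))
    have : Module.IsTorsionFree R (N ⧸ D k) := this
    have : Module.Finite R ((D j).map (D k).mkQ) :=
      Module.Finite.iff_fg.2 ((hDfg j).map _)
    have : Module.FinitePresentation R ((D j).map (D k).mkQ) :=
      Module.finitePresentation_of_finite R _
    exact Module.Flat.projective_of_finitePresentation

/-- Countably many ideals. -/
theorem aux_countable_ideals [IsDedekindDomain R]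
    (hcount : {m : Ideal R | m.IsMaximal}.Countable) : Countable (Ideal R) := by
  classical
  have : Countable {m : Ideal R | m.IsMaximal} := hcount.to_subtype
  let f : Option (Multiset {m : Ideal R | m.IsMaximal}) → Ideal R
    | none => ⊥
    | some s => (s.map Subtype.val).prod
  refine Function.Surjective.countable (f := f) ?_
  intro I
  by_cases hI : I = ⊥
  · exact ⟨none, hI.symm⟩
  · have hmax : ∀ m ∈ UniqueFactorizationMonoid.normalizedFactors I,
        m ∈ {m : Ideal R | m.IsMaximal} := by
      intro m hm
      have hp := UniqueFactorizationMonoid.prime_of_normalized_factor m hm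
      exact (Ideal.isPrime_of_prime hp).isMaximal hp.ne_zero
    refine ⟨some ((UniqueFactorizationMonoid.normalizedFactors I).attach.map
      fun x => ⟨x.1, hmax x.1 x.2⟩), ?_⟩
    simp only [f, Multiset.map_map, Function.comp_def, Multiset.attach_map_val]
    exact associated_iff_eq.1 (UniqueFactorizationMonoid.prod_normalizedFactors hI)

/-- purification of countably generated stuff is countably generated. -/
theorem aux_purify [IsNoetherianRing R] [Countable (Ideal R)]
    {L : Type v} [AddCommGroup L] [Module R L] [Module.IsTorsionFree R L]
    (T : Set L) (hT : T.Countable) :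
    ∃ T' : Set L, T'.Countable ∧ auxCl (Submodule.span R T) ≤ Submodule.span R T' := by
  classical
  have := hT.to_subtype
  -- for `I` an ideal and `F` a finite set
  let W : Ideal R → Finset T → Submodule R L := fun I F =>
    { carrier := {x | ∀ r ∈ I, r • x ∈ Submodule.span R ((↑) '' (F : Set T) : Set L)}
      zero_mem' := by intro r _; simp
      add_mem' := by
        intro x y hx hy r hr
        rw [smul_add]; exact Submodule.add_mem _ (hx r hr) (hy r hr)
      smul_mem' := by
        intro c x hx r hr
        rw [smul_comm]; exact Submodule.smul_mem _ _ (hx r hr) }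
  have hW : ∀ I F, I ≠ ⊥ → (W I F).FG := by
    intro I F hI
    obtain ⟨r, hrI, hr⟩ := Submodule.exists_mem_ne_zero_of_ne_bot hI
    have hfin : (Submodule.span R ((↑) '' (F : Set T) : Set L)).FG :=
      Submodule.fg_span (F.finite_toSet.image _)
    have : IsNoetherian R (Submodule.span R ((↑) '' (F : Set T) : Set L)) :=
      isNoetherian_of_fg_of_noetherian _ hfin
    let φ : W I F →ₗ[R] Submodule.span R ((↑) '' (F : Set T) : Set L) :=
      LinearMap.codRestrict _ (r • (W I F).subtype) (fun x => x.2 r hrI)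
    have hφ : Function.Injective φ := by
      intro x y hxy
      have h1 : r • (x : L) = r • (y : L) := congrArg Subtype.val hxy
      exact Subtype.ext (smul_right_injective L hr h1)
    have := isNoetherian_of_injective φ hφ
    exact (Submodule.fg_top _).1 (IsNoetherian.noetherian ⊤)
  have hG : ∀ I F, ∃ G : Finset L, I ≠ ⊥ → Submodule.span R (G : Set L) = W I F := by
    intro I F
    by_cases hI : I = ⊥
    · exact ⟨∅, fun h => absurd hI h⟩
    · obtain ⟨G, hG⟩ := hW I F hI
      exact ⟨G, fun _ => hG⟩
  choose G hG using hG
  refine ⟨⋃ I, ⋃ F, (G I F : Set L), ?_, ?_⟩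
  · exact Set.countable_iUnion fun I => Set.countable_iUnion fun F => (G I F).countable_toSet
  · rintro x ⟨r, hr, hx⟩
    obtain ⟨F, hF, hxF⟩ := Submodule.mem_span_finite_of_mem_span hx
    let F' : Finset T := F.subtype (· ∈ T)
    have hFF : (F : Set L) ⊆ ((↑) '' (F' : Set T) : Set L) := by
      intro y hy
      exact ⟨⟨y, hF hy⟩, by simpa [F'] using hy, rfl⟩
    have hI : Ideal.span {r} ≠ ⊥ := by simpa using hr
    have hxW : x ∈ W (Ideal.span {r}) F' := by
      intro s hs
      obtain ⟨t, rfl⟩ := Ideal.mem_span_singleton'.1 hs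
      rw [mul_smul]
      exact Submodule.smul_mem _ _ (Submodule.span_mono hFF hxF)
    rw [← hG _ _ hI] at hxW
    refine Submodule.span_mono ?_ hxW
    exact (Set.subset_iUnion (fun F => (G (Ideal.span {r}) F : Set L)) F').trans
      (Set.subset_iUnion (fun I => ⋃ F, (G I F : Set L)) _)

/-- Submodules of `A + (countably generated)` are countably generated modulo `A`. -/
theorem aux_ctbl_sub [IsNoetherianRing R] {M : Type v} [AddCommGroup M] [Module R M]
    (A K : Submodule R M) (T : Set M) (hT : T.Countable) :
    ∃ T' : Set M, T'.Countable ∧ T' ⊆ K ∧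
      K ⊓ (A ⊔ Submodule.span R T) ≤ (A ⊓ K) ⊔ Submodule.span R T' := by
  classical
  have := hT.to_subtype
  have key : ∀ F : Finset T, ∃ G : Finset M, (G : Set M) ⊆ K ∧
      K ⊓ (A ⊔ Submodule.span R ((↑) '' (F : Set T) : Set M)) ≤
        (A ⊓ K) ⊔ Submodule.span R (G : Set M) := by
    intro F
    set U := Submodule.span R ((↑) '' (F : Set T) : Set M) with hU
    have hUfg : (U.map A.mkQ).FG := (Submodule.fg_span (F.finite_toSet.image _)).map _
    have : IsNoetherian R (U.map A.mkQ) := isNoetherian_of_fg_of_noetherian _ hUfg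
    have hle : (K ⊓ (A ⊔ U)).map A.mkQ ≤ U.map A.mkQ := by
      rintro _ ⟨x, ⟨_, hx⟩, rfl⟩
      obtain ⟨a, ha, u, hu, rfl⟩ := Submodule.mem_sup.1 hx
      refine ⟨u, hu, ?_⟩
      simp [ha]
    have hfg : ((K ⊓ (A ⊔ U)).map A.mkQ).FG := by
      have := isNoetherian_of_le hle
      exact (Submodule.fg_top _).1 (IsNoetherian.noetherian ⊤)
    obtain ⟨G0, hG0⟩ := hfg
    have hsub : (G0 : Set (M ⧸ A)) ⊆ A.mkQ '' ((K ⊓ (A ⊔ U) : Submodule R M) : Set M) := by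
      have := Submodule.subset_span (R := R) (s := (G0 : Set (M ⧸ A)))
      rw [hG0] at this
      exact this
    obtain ⟨G, hGsub, hGimg⟩ := Finset.subset_set_image_iff.1 hsub
    have hGK : (G : Set M) ⊆ K := fun x hx => (hGsub hx).1
    refine ⟨G, hGK, ?_⟩
    intro x hx
    have h1 : A.mkQ x ∈ (Submodule.span R (G : Set M)).map A.mkQ := by
      rw [Submodule.map_span, ← Finset.coe_image, hGimg, hG0]
      exact ⟨x, hx, rfl⟩
    obtain ⟨g, hg, hgx⟩ := h1
    have hgK : g ∈ K := Submodule.span_le.2 hGK hg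
    have hA : x - g ∈ A := by
      rw [← Submodule.Quotient.mk_eq_zero, ← Submodule.mkQ_apply, map_sub, hgx, sub_self]
    exact Submodule.mem_sup.2 ⟨x - g, ⟨hA, K.sub_mem hx.1 hgK⟩, g, hg, by abel⟩
  choose G hGK hG using key
  refine ⟨⋃ F, (G F : Set M), Set.countable_iUnion fun F => (G F).countable_toSet,
    Set.iUnion_subset hGK, ?_⟩
  rintro x ⟨hxK, hx⟩
  obtain ⟨a, ha, u, hu, rfl⟩ := Submodule.mem_sup.1 hx
  obtain ⟨F, hF, huF⟩ := Submodule.mem_span_finite_of_mem_span hu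
  let F' : Finset T := F.subtype (· ∈ T)
  have hFF : (F : Set M) ⊆ ((↑) '' (F' : Set T) : Set M) := by
    intro y hy
    exact ⟨⟨y, hF hy⟩, by simpa [F'] using hy, rfl⟩
  have := hG F' ⟨hxK, Submodule.mem_sup.2 ⟨a, ha, u, Submodule.span_mono hFF huF, rfl⟩⟩
  have hle : Submodule.span R (G F' : Set M) ≤ Submodule.span R (⋃ F, (G F : Set M)) :=
    Submodule.span_mono (Set.subset_iUnion (fun F => (G F : Set M)) F')
  exact (sup_le_sup le_rfl hle :
    (A ⊓ K) ⊔ Submodule.span R (G F' : Set M) ≤ _) this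

theorem aux_fg_transfer {P X Y : Type*} [AddCommGroup P] [Module R P] [AddCommGroup X]
    [Module R X] [AddCommGroup Y] [Module R Y] (f : P →ₗ[R] X) (q : P →ₗ[R] Y)
    (hker : ∀ x, f x = 0 → q x = 0) (E : Submodule R P) (hE : (E.map f).FG) : (E.map q).FG := by
  classical
  obtain ⟨G0, hG0⟩ := hE
  have hsub : (G0 : Set X) ⊆ f '' (E : Set P) := by
    have := Submodule.subset_span (R := R) (s := (G0 : Set X))
    rw [hG0] at this
    exact this
  obtain ⟨G, hGsub, hGimg⟩ := Finset.subset_set_image_iff.1 hsub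
  refine ⟨G.image q, ?_⟩
  rw [Finset.coe_image, ← Submodule.map_span]
  apply le_antisymm
  · exact Submodule.map_mono (Submodule.span_le.2 hGsub)
  · rintro _ ⟨x, hx, rfl⟩
    have h1 : f x ∈ (Submodule.span R (G : Set P)).map f := by
      rw [Submodule.map_span, ← Finset.coe_image, hGimg, hG0]
      exact ⟨x, hx, rfl⟩
    obtain ⟨g, hg, hgx⟩ := h1
    refine ⟨g, hg, ?_⟩
    have := hker (g - x) (by rw [map_sub, hgx, sub_self])
    rwa [map_sub, sub_eq_zero] at this

theorem aux_fg_le [IsNoetherianRing R] {P : Type*} [AddCommGroup P] [Module R P]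
    {A B : Submodule R P} (hB : B.FG) (h : A ≤ B) : A.FG := by
  have : IsNoetherian R B := isNoetherian_of_fg_of_noetherian _ hB
  have := isNoetherian_of_le h
  exact (Submodule.fg_top _).1 (IsNoetherian.noetherian ⊤)

/-- Countably generated submodules of a module with f.g. pure closures of finite sets. -/
theorem aux_pontryagin_sub [IsDedekindDomain R] {N : Type v} [AddCommGroup N] [Module R N]
    [Module.IsTorsionFree R N]
    (hfg : ∀ T : Finset N, (auxCl (Submodule.span R (T : Set N))).FG)
    (d : ℕ → N) : Module.Projective R (Submodule.span R (Set.range d)) := by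
  classical
  set D := Submodule.span R (Set.range d) with hD
  refine aux_pontryagin (N := D) ?_ (fun k => ⟨d k, Submodule.subset_span ⟨k, rfl⟩⟩) ?_
  · intro T
    refine Submodule.fg_of_fg_map_injective D.subtype D.injective_subtype ?_
    refine aux_fg_le (hfg (T.image D.subtype)) ?_
    rintro _ ⟨x, ⟨r, hr, hx⟩, rfl⟩
    refine ⟨r, hr, ?_⟩
    rw [Finset.coe_image, ← Submodule.map_span]
    exact ⟨_, hx, rfl⟩
  · apply Submodule.map_injective_of_injective D.injective_subtype
    rw [Submodule.map_span, ← Set.range_comp, Submodule.map_top, Submodule.range_subtype]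
    rfl

/-- The section `s` and the module `A` are compatible. -/
def AuxGood {M : Type v} [AddCommGroup M] [Module R M] (Mn : ℕ → Submodule R M)
    (s : ∀ n, Mn n →ₗ[R] (Mn n →₀ R)) (A : Submodule R M) : Prop :=
  (∀ n (x : Mn n), (x : M) ∈ A → ∀ y ∈ (s n x).support, (y : M) ∈ A) ∧
    ∀ n, AuxTF (A ⊔ Mn n)

theorem aux_quot_fg [IsNoetherianRing R] {M : Type v} [AddCommGroup M] [Module R M]
    (Mn : ℕ → Submodule R M) (hmono : Monotone Mn) (hunion : ⨆ n, Mn n = ⊤)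
    (s : ∀ n, Mn n →ₗ[R] (Mn n →₀ R))
    (hs : ∀ n x, Finsupp.linearCombination R id (s n x) = x)
    (A : Submodule R M) (hA : AuxGood Mn s A) (T : Finset (M ⧸ A)) :
    (auxCl (Submodule.span R (T : Set (M ⧸ A)))).FG := by
  classical
  have hdir : Directed (· ≤ ·) Mn := hmono.directed_le
  have hTn : ∃ n, (T : Set (M ⧸ A)) ⊆ ((Mn n).map A.mkQ : Submodule R (M ⧸ A)) := by
    induction T using Finset.induction_on with
    | empty => exact ⟨0, by simp⟩
    | insert t T _ ih =>
      obtain ⟨n, hn⟩ := ih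
      obtain ⟨m, rfl⟩ := Submodule.mkQ_surjective A t
      have hm : m ∈ ⨆ n, Mn n := by rw [hunion]; trivial
      obtain ⟨k, hk⟩ := (Submodule.mem_iSup_of_directed _ hdir).1 hm
      refine ⟨max n k, ?_⟩
      rw [Finset.coe_insert, Set.insert_subset_iff]
      exact ⟨⟨m, hmono (le_max_right n k) hk, rfl⟩,
        hn.trans (Submodule.map_mono (hmono (le_max_left n k)))⟩
  obtain ⟨n, hn⟩ := hTn
  let q : Mn n →ₗ[R] M ⧸ A := A.mkQ ∘ₗ (Mn n).subtype
  let Xc : Set (Mn n) := {y | (y : M) ∉ A}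
  let h : Mn n →ₗ[R] (Xc →₀ R) := Finsupp.lsubtypeDomain Xc ∘ₗ s n
  have hh : ∀ x y, h x y = s n x y := fun x y => rfl
  have hq0 : ∀ x, q x = 0 ↔ (x : M) ∈ A := fun x => Submodule.Quotient.mk_eq_zero A
  have hker1 : ∀ x, q x = 0 → h x = 0 := by
    intro x hx
    ext y
    rw [hh]
    by_contra hne
    exact y.2 (hA.1 n x ((hq0 x).1 hx) y (Finsupp.mem_support_iff.2 hne))
  have hker2 : ∀ x, h x = 0 → q x = 0 := by
    intro x hx
    rw [hq0]
    rw [← hs n x, Finsupp.linearCombination_apply, Finsupp.sum, Submodule.coe_sum]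
    refine Submodule.sum_mem _ fun y hy => ?_
    refine Submodule.smul_mem A _ ?_
    by_contra hyA
    exact Finsupp.mem_support_iff.1 hy (DFunLike.congr_fun hx (⟨y, hyA⟩ : Xc))
  have hsub : (T : Set (M ⧸ A)) ⊆ q '' (Set.univ : Set (Mn n)) := by
    intro t ht
    obtain ⟨m, hm, rfl⟩ := hn ht
    exact ⟨⟨m, hm⟩, trivial, rfl⟩
  obtain ⟨T', -, hT'⟩ := Finset.subset_set_image_iff.1 hsub
  let V : Finset Xc := T'.biUnion fun t => (h t).support
  have hspanV : ∀ t ∈ Submodule.span R (T' : Set (Mn n)), h t ∈ Finsupp.supported R R (V : Set Xc) := by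
    have : Submodule.span R (T' : Set (Mn n)) ≤ (Finsupp.supported R R (V : Set Xc)).comap h := by
      rw [Submodule.span_le]
      intro t ht
      change h t ∈ Finsupp.supported R R (V : Set Xc)
      rw [Finsupp.mem_supported]
      exact_mod_cast Finset.subset_biUnion_of_mem (fun t => (h t).support) ht
    exact this
  set C := auxCl (Submodule.span R (T : Set (M ⧸ A))) with hC
  let E : Submodule R (Mn n) := C.comap q
  have hCE : C = E.map q := by
    apply le_antisymm
    · rintro x ⟨r, hr, hx⟩
      obtain ⟨x, rfl⟩ := Submodule.mkQ_surjective A x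
      have h1 : r • A.mkQ x ∈ (Mn n).map A.mkQ := Submodule.span_le.2 hn hx
      obtain ⟨m, hm, hmx⟩ := h1
      have h2 : r • x - m ∈ A := by
        rw [← Submodule.Quotient.mk_eq_zero, ← Submodule.mkQ_apply, map_sub, map_smul, hmx,
          sub_self]
      have h3 : r • x ∈ A ⊔ Mn n := Submodule.mem_sup.2 ⟨_, h2, m, hm, by abel⟩
      obtain ⟨a, ha, m', hm', hxm⟩ := Submodule.mem_sup.1 (hA.2 n r hr x h3)
      have hqx : q ⟨m', hm'⟩ = A.mkQ x := by
        rw [← hxm, map_add, (Submodule.Quotient.mk_eq_zero A).2 ha |> fun h => (h : A.mkQ a = 0),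
          zero_add]
        rfl
      refine ⟨⟨m', hm'⟩, ?_, hqx⟩
      change q ⟨m', hm'⟩ ∈ C
      rw [hqx]
      exact ⟨r, hr, hx⟩
    · exact Submodule.map_comap_le _ _
  rw [hCE]
  refine aux_fg_transfer h q hker2 E ?_
  have hVfg : (Finsupp.supported R R (V : Set Xc)).FG := by
    rw [Finsupp.supported_eq_span_single]
    exact Submodule.fg_span (V.finite_toSet.image _)
  refine aux_fg_le hVfg ?_
  rintro _ ⟨x, ⟨r, hr, hx⟩, rfl⟩
  rw [← hT', Finset.coe_image, ← Submodule.map_span] at hx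
  obtain ⟨t, ht, htx⟩ := hx
  have h1 : h (r • x - t) = 0 := hker1 _ (by rw [map_sub, map_smul, htx, sub_self])
  have h2 : r • h x = h t := by rwa [map_sub, map_smul, sub_eq_zero] at h1
  have h3 := hspanV t ht
  rw [← h2, Finsupp.mem_supported'] at h3
  rw [Finsupp.mem_supported']
  intro y hy
  have := h3 y hy
  rw [Finsupp.smul_apply, smul_eq_mul] at this
  exact (mul_eq_zero.1 this).resolve_left hr

theorem aux_step1 [IsNoetherianRing R] {M : Type v} [AddCommGroup M] [Module R M]
    (Mn : ℕ → Submodule R M) (s : ∀ n, Mn n →ₗ[R] (Mn n →₀ R))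
    (A : Submodule R M) (hA : AuxGood Mn s A) (n : ℕ) (T : Set M) (hT : T.Countable) :
    ∃ T' : Set M, T'.Countable ∧ ∀ x : Mn n, (x : M) ∈ A ⊔ Submodule.span R T →
      ∀ y ∈ (s n x).support, (y : M) ∈ A ⊔ Submodule.span R T' := by
  classical
  obtain ⟨G, hGc, hGK, hG⟩ := aux_ctbl_sub A (Mn n) T hT
  let G' : Set (Mn n) := (↑) ⁻¹' G
  have hG'c : G'.Countable := hGc.preimage Subtype.val_injective
  let T' : Set (Mn n) := ⋃ g ∈ G', ((s n g).support : Set (Mn n))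
  have hT'c : T'.Countable := hG'c.biUnion fun g _ => (s n g).support.countable_toSet
  refine ⟨(↑) '' T', hT'c.image _, ?_⟩
  set B := A ⊔ Submodule.span R ((↑) '' T' : Set M) with hB
  let Z : Submodule R (Mn n) :=
    (Finsupp.supported R R {y : Mn n | (y : M) ∈ B}).comap (s n)
  have hZ : ∀ x : Mn n, x ∈ Z ↔ ∀ y ∈ (s n x).support, (y : M) ∈ B := by
    intro x
    change s n x ∈ Finsupp.supported R R {y : Mn n | (y : M) ∈ B} ↔ _
    rw [Finsupp.mem_supported]
    rfl
  have hle : (A ⊓ Mn n) ⊔ Submodule.span R G ≤ Z.map (Mn n).subtype := by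
    refine sup_le ?_ (Submodule.span_le.2 ?_)
    · rintro a ⟨haA, han⟩
      refine ⟨⟨a, han⟩, (hZ _).2 fun y hy => ?_, rfl⟩
      exact (le_sup_left : A ≤ B) (hA.1 n ⟨a, han⟩ haA y hy)
    · intro g hg
      refine ⟨⟨g, hGK hg⟩, (hZ _).2 fun y hy => ?_, rfl⟩
      refine (le_sup_right : _ ≤ B) (Submodule.subset_span ⟨y, ?_, rfl⟩)
      exact Set.mem_biUnion (x := (⟨g, hGK hg⟩ : Mn n)) (by exact hg) hy
  intro x hx
  obtain ⟨z, hz, hzx⟩ := hle (hG ⟨x.2, hx⟩)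
  have : z = x := Subtype.ext hzx
  subst this
  exact (hZ _).1 hz

theorem aux_step2 [IsNoetherianRing R] [Countable (Ideal R)]
    {M : Type v} [AddCommGroup M] [Module R M]
    (B : Submodule R M) (hB : AuxTF B) (T : Set M) (hT : T.Countable) :
    ∃ T' : Set M, T'.Countable ∧ ∀ r : R, r ≠ 0 → ∀ x : M, r • x ∈ B ⊔ Submodule.span R T →
      x ∈ B ⊔ Submodule.span R T' := by
  classical
  have := aux_tf_quot hB
  obtain ⟨G, hGc, hG⟩ := aux_purify (R := R) (B.mkQ '' T) (hT.image _)
  refine ⟨Function.surjInv (Submodule.mkQ_surjective B) '' G, hGc.image _, ?_⟩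
  intro r hr x hx
  have h1 : B.mkQ x ∈ auxCl (Submodule.span R (B.mkQ '' T)) := by
    refine ⟨r, hr, ?_⟩
    obtain ⟨b, hb, t, ht, hbt⟩ := Submodule.mem_sup.1 hx
    rw [← Submodule.map_span]
    refine ⟨t, ht, ?_⟩
    rw [← map_smul, ← hbt, map_add]
    have : B.mkQ b = 0 := (Submodule.Quotient.mk_eq_zero B).2 hb
    rw [this, zero_add]
  have h2 := hG h1
  have h3 : G = B.mkQ '' (Function.surjInv (Submodule.mkQ_surjective B) '' G) := by
    rw [Set.image_image]
    simp only [Function.surjInv_eq]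
    simp
  rw [h3, ← Submodule.map_span] at h2
  obtain ⟨g, hg, hgx⟩ := h2
  have hBx : x - g ∈ B := by
    rw [← Submodule.Quotient.mk_eq_zero, ← Submodule.mkQ_apply, map_sub, hgx, sub_self]
  exact Submodule.mem_sup.2 ⟨_, hBx, g, hg, by abel⟩

theorem aux_extend [IsNoetherianRing R] [Countable (Ideal R)]
    {M : Type v} [AddCommGroup M] [Module R M]
    (Mn : ℕ → Submodule R M) (s : ∀ n, Mn n →ₗ[R] (Mn n →₀ R))
    (A : Submodule R M) (hA : AuxGood Mn s A) (x0 : M) :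
    ∃ T : Set M, T.Countable ∧ x0 ∈ T ∧ AuxGood Mn s (A ⊔ Submodule.span R T) := by
  classical
  have step : ∀ T : {T : Set M // T.Countable}, ∃ T' : {T : Set M // T.Countable}, T.1 ⊆ T'.1 ∧
      (∀ n (x : Mn n), (x : M) ∈ A ⊔ Submodule.span R T.1 →
        ∀ y ∈ (s n x).support, (y : M) ∈ A ⊔ Submodule.span R T'.1) ∧
      (∀ n (r : R), r ≠ 0 → ∀ x : M, r • x ∈ (A ⊔ Mn n) ⊔ Submodule.span R T.1 →
        x ∈ (A ⊔ Mn n) ⊔ Submodule.span R T'.1) := by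
    rintro ⟨T, hT⟩
    choose F hFc hF using fun n => aux_step1 Mn s A hA n T hT
    choose G hGc hG using fun n => aux_step2 (A ⊔ Mn n) (hA.2 n) T hT
    refine ⟨⟨T ∪ ((⋃ n, F n) ∪ ⋃ n, G n), hT.union ((Set.countable_iUnion hFc).union
      (Set.countable_iUnion hGc))⟩, Set.subset_union_left, ?_, ?_⟩
    · intro n x hx y hy
      refine (sup_le_sup (le_refl A) (Submodule.span_mono ?_)) (hF n x hx y hy)
      exact fun z hz => Or.inr (Or.inl (Set.mem_iUnion.2 ⟨n, hz⟩))
    · intro n r hr x hx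
      refine (sup_le_sup (le_refl (A ⊔ Mn n)) (Submodule.span_mono ?_)) (hG n r hr x hx)
      exact fun z hz => Or.inr (Or.inr (Set.mem_iUnion.2 ⟨n, hz⟩))
  choose next hsub hP hQ using step
  let S : ℕ → {T : Set M // T.Countable} := fun k =>
    Nat.rec ⟨{x0}, Set.countable_singleton x0⟩ (fun _ T => next T) k
  have hSmono : Monotone fun k => (S k).1 := monotone_nat_of_le_succ fun k => hsub (S k)
  have hmem : ∀ (B : Submodule R M) (x : M), x ∈ B ⊔ Submodule.span R (⋃ k, (S k).1) →
      ∃ k, x ∈ B ⊔ Submodule.span R (S k).1 := by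
    intro B x hx
    obtain ⟨b, hb, t, ht, rfl⟩ := Submodule.mem_sup.1 hx
    rw [Submodule.span_iUnion, Submodule.mem_iSup_of_directed] at ht
    · obtain ⟨k, hk⟩ := ht
      exact ⟨k, Submodule.mem_sup.2 ⟨b, hb, t, hk, rfl⟩⟩
    · exact Monotone.directed_le fun i j hij => Submodule.span_mono (hSmono hij)
  have hle : ∀ (B : Submodule R M) k, B ⊔ Submodule.span R (S k).1 ≤
      B ⊔ Submodule.span R (⋃ k, (S k).1) := fun B k =>
    sup_le_sup le_rfl (Submodule.span_mono (Set.subset_iUnion (fun k => (S k).1) k))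
  refine ⟨⋃ k, (S k).1, Set.countable_iUnion fun k => (S k).2,
    Set.mem_iUnion.2 ⟨0, rfl⟩, ?_, ?_⟩
  · intro n x hx y hy
    obtain ⟨k, hk⟩ := hmem A x hx
    exact hle A (k + 1) (hP (S k) n x hk y hy)
  · intro n r hr x hx
    rw [sup_right_comm] at hx ⊢
    obtain ⟨k, hk⟩ := hmem _ _ hx
    exact hle _ (k + 1) (hQ (S k) n r hr x hk)

end helpers

/-- over a Dedekind domain with countably many maximal ideals, a
torsion-free module which is the union of a countable ascending chain of projective
pure submodules is projective. -/
theorem stmt11 [IsDedekindDomain R]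
    (hcount : {m : Ideal R | m.IsMaximal}.Countable)
    {M : Type v} [AddCommGroup M] [Module R M] [NoZeroSMulDivisors R M]
    (Mn : ℕ → Submodule R M) (hmono : Monotone Mn)
    (h0 : Mn 0 = ⊥) (hunion : ⨆ n, Mn n = ⊤)
    (hproj : ∀ n, Module.Projective R ↥(Mn n))
    (hpure : ∀ n, IsPureSub R (Mn n)) :
    Module.Projective R M := by
  classical
  have hcI : Countable (Ideal R) := aux_countable_ideals hcount
  have hTF : ∀ n, AuxTF (Mn n) := by
    intro n r hr x hx
    obtain ⟨y, hy, hyx⟩ := hpure n 1 1 (fun _ _ => r) (fun _ => r • x) (fun _ => hx)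
      ⟨fun _ => x, fun _ => by simp⟩
    have h1 : r • y 0 = r • x := by simpa using hyx 0
    have h2 : r • (y 0 - x) = 0 := by rw [smul_sub, h1, sub_self]
    have h3 : y 0 - x = 0 := (NoZeroSMulDivisors.eq_zero_or_eq_zero_of_smul_eq_zero h2).resolve_left hr
    rw [← sub_eq_zero.1 h3]
    exact hy 0
  choose s hs using fun n => (hproj n).out
  refine aux_devissage {A | AuxGood Mn s A} ⟨?_, ?_⟩ ?_ ?_
  · intro n x hx y hy
    have : x = 0 := Subtype.ext ((Submodule.mem_bot R).1 hx)
    subst this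
    simp at hy
  · intro n
    rw [bot_sup_eq]
    exact hTF n
  · intro c hc hne hch
    have hd : DirectedOn (· ≤ ·) c := hch.directedOn
    refine ⟨?_, ?_⟩
    · intro n x hx y hy
      obtain ⟨A, hAc, hxA⟩ := (Submodule.mem_sSup_of_directed hne hd).1 hx
      exact le_sSup hAc ((hc hAc).1 n x hxA y hy)
    · intro n r hr x hx
      obtain ⟨a, ha, m, hm, ham⟩ := Submodule.mem_sup.1 hx
      obtain ⟨A, hAc, haA⟩ := (Submodule.mem_sSup_of_directed hne hd).1 ha
      have := (hc hAc).2 n r hr x (Submodule.mem_sup.2 ⟨a, haA, m, hm, ham⟩)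
      exact (sup_le_sup (le_sSup hAc) (le_refl (Mn n))) this
  · intro A hA htop
    obtain ⟨x0, hx0⟩ : ∃ x, x ∉ A := by
      by_contra hcon
      push Not at hcon
      exact htop (eq_top_iff.2 fun x _ => hcon x)
    obtain ⟨T, hTc, hxT, hgood⟩ := aux_extend Mn s A hA x0
    refine ⟨_, hgood, lt_of_le_not_ge le_sup_left fun h => hx0 (h ?_), ?_⟩
    · exact (le_sup_right : _ ≤ A ⊔ Submodule.span R T) (Submodule.subset_span hxT)
    · have hAtf : AuxTF A := by simpa [h0] using hA.2 0
      have := aux_tf_quot hAtf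
      obtain ⟨d, hd⟩ := (hTc.image A.mkQ).exists_eq_range ⟨_, x0, hxT, rfl⟩
      have heq : (A ⊔ Submodule.span R T).map A.mkQ = Submodule.span R (Set.range d) := by
        rw [Submodule.map_sup, Submodule.map_span, hd, Submodule.mkQ_map_self, bot_sup_eq]
      rw [heq]
      exact aux_pontryagin_sub (aux_quot_fg Mn hmono hunion s hs A hA) d
end
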